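/- Let P be a one-parameter FISI deformation of a polynomial f₀ of degree d ≥ 2 whose total space Y is nonsingular for |s| small (equivalently Σ₀ ∩ {φ_d = 0} = ∅). Let p ∈ Σ₀, regarded as a point of the hyperplane at infinity, and let t₀ ∈ ℂ. Then λ_{p,t₀}(0) ≠ 0 if and only if (p, 0, t₀) belongs to the affine critical locus Γ_P, i.e. if and only if there exists a sequence (x_k, s_k) with ∂P/∂x_i(x_k, s_k) = 0 for all i, s_k → 0, [x_k : 1] → p in ℙⁿ, and P(x_k, s_k) → t₀. -/

import Mathlib

open MvPolynomial Filter CategoryTheory Limits Topology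

noncomputable section

abbrev XS (n : ℕ) := Fin n ⊕ Unit
abbrev HV (n : ℕ) := Fin n ⊕ Unit
abbrev TV (n : ℕ) := Fin n ⊕ Fin 3

/-- ℙ^{n-1}, the hyperplane at infinity of ℙⁿ. -/
abbrev PrjInf (n : ℕ) := Projectivization ℂ (Fin n → ℂ)
/-- ℙⁿ. -/
abbrev Prj (n : ℕ) := Projectivization ℂ (HV n → ℂ)

/-- weights for the degree in the `x`-variables only: `s` has weight `0`. -/
def wtx (n : ℕ) : XS n → ℕ := Sum.elim (fun _ => 1) (fun _ => 0)

/-- `P_q`, the degree-`q` homogeneous part of `P` in the variables `x`. -/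
def xpart {n : ℕ} (P : MvPolynomial (XS n) ℂ) (q : ℕ) : MvPolynomial (XS n) ℂ :=
  weightedHomogeneousComponent (wtx n) q P

/-- the evaluation point `(x, s)`. -/
def evA {n : ℕ} (x : Fin n → ℂ) (s : ℂ) : XS n → ℂ := Sum.elim x (fun _ => s)

/-- `deg_x P(·,s) = d` at the parameter value `s`. -/
def DegXAt {n : ℕ} (d : ℕ) (P : MvPolynomial (XS n) ℂ) (s : ℂ) : Prop :=
  (∀ q, d < q → ∀ x : Fin n → ℂ, eval (evA x s) (xpart P q) = 0) ∧
  (∃ x : Fin n → ℂ, eval (evA x s) (xpart P d) ≠ 0)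

/-- the substitution embedding the variables `(x,s)` into the variables `(x,x₀,s,t)`. -/
def embT {n : ℕ} : XS n → MvPolynomial (TV n) ℂ :=
  Sum.elim (fun i => X (Sum.inl i)) (fun _ => X (Sum.inr 1))

/-- The defining polynomial `F = P̃(x,x₀,s) - t·x₀^d` of the total space
`Y ⊂ ℙⁿ × ℂ_s × ℂ_t`, where `P̃ = Σ_{q ≤ d} x₀^{d-q} P_q(x,s)` is the homogenization
of `P` in `x` by the variable `x₀`. -/
def FY {n : ℕ} (d : ℕ) (P : MvPolynomial (XS n) ℂ) : MvPolynomial (TV n) ℂ :=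
  (∑ q ∈ Finset.range (d+1), (X (Sum.inr 0))^(d-q) * aeval embT (xpart P q))
    - X (Sum.inr 2) * (X (Sum.inr 0))^d

/-- the evaluation point `((x,x₀), s, t)` of the variables of `FY`. -/
def evT {n : ℕ} (u : HV n → ℂ) (s t : ℂ) : TV n → ℂ :=
  Sum.elim (fun i => u (Sum.inl i)) ![u (Sum.inr ()), s, t]

/-- `([u], s, t) ∈ Y`. -/
def OnY {n : ℕ} (d : ℕ) (P : MvPolynomial (XS n) ℂ) (u : HV n → ℂ) (s t : ℂ) : Prop :=
  eval (evT u s t) (FY d P) = 0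

/-- all partial derivatives of the defining equation of `Y` — with respect to the
homogeneous coordinates `(x, x₀)` and the affine coordinates `s, t` — vanish at
`([u], s, t)`; together with `OnY` this says `([u],s,t)` is a singular point of `Y`. -/
def AllDerivsVanish {n : ℕ} (d : ℕ) (P : MvPolynomial (XS n) ℂ) (u : HV n → ℂ)
    (s t : ℂ) : Prop :=
  ∀ v : TV n, eval (evT u s t) (pderiv v (FY d P)) = 0

/-- the partial derivatives with respect to the homogeneous coordinates `(x, x₀)`
vanish at `([u], s, t)`; together with `OnY` this says `[u]` is a singular point of the
projective fiber `Y_{s,t}`. -/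
def FiberDerivsVanish {n : ℕ} (d : ℕ) (P : MvPolynomial (XS n) ℂ) (u : HV n → ℂ)
    (s t : ℂ) : Prop :=
  (∀ i : Fin n, eval (evT u s t) (pderiv (Sum.inl i) (FY d P)) = 0) ∧
    eval (evT u s t) (pderiv (Sum.inr 0) (FY d P)) = 0

/-- the partial derivatives with respect to `(x, x₀)` and `t` (but not `s`) vanish;
together with `OnY` this identifies the singular points of `Y_{s,ℂ}`, resp. the critical
points of the projection `σ : Y → ℂ_s`. -/
def SliceDerivsVanish {n : ℕ} (d : ℕ) (P : MvPolynomial (XS n) ℂ) (u : HV n → ℂ)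
    (s t : ℂ) : Prop :=
  FiberDerivsVanish d P u s t ∧ eval (evT u s t) (pderiv (Sum.inr 2) (FY d P)) = 0

/-- `[x] ∈ W_s`: all `∂P_d/∂x_i` vanish at `(x,s)`. -/
def WCond {n : ℕ} (d : ℕ) (P : MvPolynomial (XS n) ℂ) (x : Fin n → ℂ) (s : ℂ) : Prop :=
  ∀ i : Fin n, eval (evA x s) (pderiv (Sum.inl i) (xpart P d)) = 0

/-- `[x] ∈ Σ_s`: moreover `P_{d-1}(x,s) = 0`. -/
def SCond {n : ℕ} (d : ℕ) (P : MvPolynomial (XS n) ℂ) (x : Fin n → ℂ) (s : ℂ) : Prop :=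
  WCond d P x s ∧ eval (evA x s) (xpart P (d-1)) = 0

/-- `φ_d(x) = ∂P_d/∂s (x, 0) = 0`. -/
def PhiCond {n : ℕ} (d : ℕ) (P : MvPolynomial (XS n) ℂ) (x : Fin n → ℂ) : Prop :=
  eval (evA x 0) (pderiv (Sum.inr ()) (xpart P d)) = 0

/-- `W_s ⊂ ℙ^{n-1}` as a set of projective points. -/
def Wset {n : ℕ} (d : ℕ) (P : MvPolynomial (XS n) ℂ) (s : ℂ) : Set (PrjInf n) :=
  {p | WCond d P p.rep s}

/-- `Σ_s ⊂ ℙ^{n-1}` as a set of projective points. -/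
def Sigset {n : ℕ} (d : ℕ) (P : MvPolynomial (XS n) ℂ) (s : ℂ) : Set (PrjInf n) :=
  {p | SCond d P p.rep s}

/-- `f_s = P(·,s)` as a polynomial in `x`. -/
def fS {n : ℕ} (P : MvPolynomial (XS n) ℂ) (s : ℂ) : MvPolynomial (Fin n) ℂ :=
  aeval (Sum.elim X (fun _ => C s)) P

/-- `x` is an affine critical point of `f_s`, i.e. `∂P/∂x_i(x,s) = 0` for all `i`. -/
def CritPt {n : ℕ} (P : MvPolynomial (XS n) ℂ) (x : Fin n → ℂ) (s : ℂ) : Prop :=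
  ∀ i : Fin n, eval (evA x s) (pderiv (Sum.inl i) P) = 0

/-- the set of singular points of the compactified fiber `Y_{s,t} ⊂ ℙⁿ`. -/
def SingYst {n : ℕ} (d : ℕ) (P : MvPolynomial (XS n) ℂ) (s t : ℂ) : Set (Prj n) :=
  {p | OnY d P p.rep s t ∧ FiberDerivsVanish d P p.rep s t}

/-- `f₀ = P(·,0)` is a FISI polynomial: it has finitely many critical points, the
projective closure of each of its fibers has only isolated (= finitely many) singular
points, and the singular locus `W₀` of the slice at infinity is finite. -/
def FISIat {n : ℕ} (d : ℕ) (P : MvPolynomial (XS n) ℂ) (s : ℂ) : Prop :=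
  {x : Fin n → ℂ | CritPt P x s}.Finite ∧ (∀ t : ℂ, (SingYst d P s t).Finite) ∧
    (Wset d P s).Finite

/-- `P` is a FISI deformation: `f₀` is FISI, `W₀` is finite and every `f_s`, for `s` in a
neighbourhood of `0`, has only finitely many critical points. -/
def FISIdef {n : ℕ} (d : ℕ) (P : MvPolynomial (XS n) ℂ) : Prop :=
  FISIat d P 0 ∧ ∃ ε > (0:ℝ), ∀ s : ℂ, ‖s‖ < ε → {x : Fin n → ℂ | CritPt P x s}.Finite

/-- The "Milnor-type" local dimension: given polynomial germs `gs` at a point `a ∈ ℂᵐ`,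
this is the `ℂ`-dimension of the formal power series ring at `a` (identified with
`ℂ[[X]]` via `X ↦ X - a`) modulo the ideal generated by the germs. -/
def germDim {m : ℕ} (gs : Set (MvPolynomial (Fin m) ℂ)) (a : Fin m → ℂ) : ℕ :=
  Module.finrank ℂ (MvPowerSeries (Fin m) ℂ ⧸ Ideal.span
    ((fun g => (MvPolynomial.coeToMvPowerSeries.ringHom
        (aeval (fun i => X i + C (a i)) g) : MvPowerSeries (Fin m) ℂ)) '' gs))

/-- the (choice of an) index `j` with `p.rep j ≠ 0`, used to normalize `v_j = 1`
and to work in the chart `x_j = 1` of `ℙⁿ`. -/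
def jp {n : ℕ} (p : PrjInf n) : Fin n :=
  (Function.ne_iff.mp p.rep_nonzero).choose

lemma jp_spec {n : ℕ} (p : PrjInf n) : p.rep (jp p) ≠ 0 :=
  (Function.ne_iff.mp p.rep_nonzero).choose_spec

/-- the chart coordinates of the point at infinity `p = [v:0]`, where `v` is normalized
by `v_{j(p)} = 1`, in the chart `x_{j(p)} = 1` of `ℙⁿ`; the slot `j(p)` of the chart
carries the coordinate `x₀`, which is `0` at `p`. -/
def chartPt {n : ℕ} (p : PrjInf n) : Fin n → ℂ :=
  fun i => if i = jp p then 0 else p.rep i / p.rep (jp p)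

/-- the chart equation of the compactified fiber `Y_{s,t}` in the chart `x_j = 1` of
`ℙⁿ`: substitute `x_j = 1` in the homogeneous defining equation `FY`, the chart slot `j`
carrying the coordinate `x₀`. -/
def chartEq {n : ℕ} (d : ℕ) (P : MvPolynomial (XS n) ℂ) (j : Fin n) (s t : ℂ) :
    MvPolynomial (Fin n) ℂ :=
  aeval (Sum.elim (fun i => if i = j then 1 else X i) ![X j, C s, C t]) (FY d P)

/-- the chart equation of the hypersurface `{P_d(·,s) = 0} ⊂ ℙ^{n-1}` in the chart
`x_j = 1` of `ℙ^{n-1}` (the chart variable `X j` is unused). -/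
def chartEqInf {n : ℕ} (d : ℕ) (P : MvPolynomial (XS n) ℂ) (j : Fin n) (s : ℂ) :
    MvPolynomial (Fin n) ℂ :=
  aeval (fun i => if i = j then 1 else X i) (aeval (Sum.elim X (fun _ => C s)) (xpart P d))

/-- `μ_p(t,s)`, the Milnor number of the isolated singularity of the compactified fiber
`Y_{s,t}` at the point `p` of the hyperplane at infinity. -/
def muP {n : ℕ} (d : ℕ) (P : MvPolynomial (XS n) ℂ) (p : PrjInf n) (s t : ℂ) : ℕ :=
  germDim (Set.range fun i => pderiv i (chartEq d P (jp p) s t)) (chartPt p)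

/-- `μ_{p,gen}(s) = min_{t ∈ ℂ} μ_p(t,s)`. -/
def muGen {n : ℕ} (d : ℕ) (P : MvPolynomial (XS n) ℂ) (p : PrjInf n) (s : ℂ) : ℕ :=
  sInf (Set.range (muP d P p s))

/-- the local Milnor–Lê number `λ_{p,t}(s) = μ_p(t,s) − μ_{p,gen}(s)`. -/
def lamP {n : ℕ} (d : ℕ) (P : MvPolynomial (XS n) ℂ) (p : PrjInf n) (t s : ℂ) : ℕ :=
  muP d P p s t - muGen d P p s

/-- `μ_p^∞(s)`, the Milnor number at `p` of the hypersurface `{P_d(·,s)=0} ⊂ ℙ^{n-1}`: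
computed in the chart `x_{j(p)} = 1`, adding the generator `X (j p)` to kill the unused
chart variable. -/
def muInf {n : ℕ} (d : ℕ) (P : MvPolynomial (XS n) ℂ) (p : PrjInf n) (s : ℂ) : ℕ :=
  germDim ({g | ∃ i, i ≠ jp p ∧ g = pderiv i (chartEqInf d P (jp p) s)} ∪ {X (jp p)})
    (chartPt p)

/-- the total Milnor number `μ(s)` of the affine singularities of `f_s`. -/
def muTot {n : ℕ} (P : MvPolynomial (XS n) ℂ) (s : ℂ) : ℕ :=
  Module.finrank ℂ (MvPolynomial (Fin n) ℂ ⧸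
    Ideal.span (Set.range fun i => pderiv i (fS P s)))

/-- the local Milnor number `μ_a(f_s)` of `f_s` at the point `a ∈ ℂⁿ`. -/
def muAt {n : ℕ} (P : MvPolynomial (XS n) ℂ) (s : ℂ) (a : Fin n → ℂ) : ℕ :=
  germDim (Set.range fun i => pderiv i (fS P s)) a

/-- the total Milnor–Lê number at infinity `λ(s) = Σ_{p ∈ Σ_s} Σ_{t ∈ ℂ} λ_{p,t}(s)`
(all but finitely many summands vanish). -/
def lamTot {n : ℕ} (d : ℕ) (P : MvPolynomial (XS n) ℂ) (s : ℂ) : ℕ :=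
  ∑ᶠ p ∈ Sigset d P s, ∑ᶠ t : ℂ, lamP d P p t s

/-- the chart coordinates of the affine point `[x : 1] ∈ ℙⁿ` in the chart `x_j = 1`,
the slot `j` carrying the coordinate `x₀` (i.e. `1/x_j`). -/
def chartCo {n : ℕ} (j : Fin n) (x : Fin n → ℂ) : Fin n → ℂ :=
  fun i => if i = j then 1 / x j else x i / x j

/-- the affine discriminant `Δ_P ⊂ ℂ_s × ℂ_t`: the closure of the set of pairs
`(s, f_s(x))` over the affine critical points `x` of `f_s`. -/
def DeltaP {n : ℕ} (P : MvPolynomial (XS n) ℂ) : Set (ℂ × ℂ) :=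
  closure {w : ℂ × ℂ | ∃ x : Fin n → ℂ, CritPt P x w.1 ∧ w.2 = eval (evA x w.1) P}

section

namespace PF

/-! ### Freeness of `T[z]/(z_i^M + lower order)` -/

section Free
variable {T : Type*} [CommRing T] {σ : Type*}

/-- polynomials all of whose monomials have degree `< k`. -/
def Low (T : Type*) [CommRing T] (σ : Type*) (k : ℕ) : Submodule T (MvPolynomial σ T) where
  carrier := {p | ∀ β : σ →₀ ℕ, k ≤ β.degree → coeff β p = 0}
  add_mem' := by
    intro a b ha hb β hβ
    simp [ha β hβ, hb β hβ]
  zero_mem' := by intro β _; simp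
  smul_mem' := by
    intro c a ha β hβ
    simp [ha β hβ]

lemma Low_mul {a b : ℕ} {p q : MvPolynomial σ T} (hp : p ∈ Low T σ a)
    (hq : q ∈ Low T σ (b+1)) : p * q ∈ Low T σ (a+b) := by
  classical
  intro β hβ
  rw [coeff_mul]
  apply Finset.sum_eq_zero
  rintro ⟨x, y⟩ hxy
  rw [Finset.HasAntidiagonal.mem_antidiagonal] at hxy
  have : x.degree + y.degree = β.degree := by rw [← hxy, map_add]
  by_cases h : a ≤ x.degree
  · simp [hp x h]
  · have : b + 1 ≤ y.degree := by simp at *; omega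
    simp [hq y this]

lemma Low_mono {a b : ℕ} (h : a ≤ b) : Low T σ a ≤ Low T σ b :=
  fun _ hp β hβ => hp β (h.trans hβ)

lemma monomial_mem_Low (α : σ →₀ ℕ) (c : T) : monomial α c ∈ Low T σ (α.degree + 1) := by
  classical
  intro β hβ
  rw [coeff_monomial, if_neg]
  rintro rfl; omega

/-- `p` has leading monomial `z^α` in the strong sense. -/
def Lead (p : MvPolynomial σ T) (α : σ →₀ ℕ) : Prop := p - monomial α 1 ∈ Low T σ α.degree

lemma Lead.mul {p q : MvPolynomial σ T} {α β : σ →₀ ℕ} (hp : Lead p α) (hq : Lead q β) :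
    Lead (p * q) (α + β) := by
  have hq1 : q ∈ Low T σ (β.degree + 1) := by
    have := Submodule.add_mem _ (Low_mono (Nat.le_succ _) hq) (monomial_mem_Low β 1)
    simpa using this
  have e : p * q - monomial (α + β) 1 = (p - monomial α 1) * q
      + (q - monomial β 1) * monomial α 1 := by
    have : (monomial (α+β) (1:T)) = monomial α 1 * monomial β 1 := by
      rw [monomial_mul, one_mul]
    rw [this]; ring
  unfold Lead
  rw [e, map_add]
  refine Submodule.add_mem _ (Low_mul hp hq1) ?_
  rw [add_comm]
  exact Low_mul hq (monomial_mem_Low α 1)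

lemma Lead.one : Lead (1 : MvPolynomial σ T) 0 := by
  unfold Lead
  have : (1 : MvPolynomial σ T) = monomial 0 1 := rfl
  rw [this]; simp

lemma Lead.pow {p : MvPolynomial σ T} {α : σ →₀ ℕ} (hp : Lead p α) (k : ℕ) :
    Lead (p ^ k) (k • α) := by
  induction k with
  | zero => simpa using Lead.one
  | succ k ih => rw [pow_succ, succ_nsmul]; exact ih.mul hp

lemma Lead.prod {ι : Type*} (s : Finset ι) {p : ι → MvPolynomial σ T} {α : ι → σ →₀ ℕ}
    (hp : ∀ i, Lead (p i) (α i)) : Lead (∏ i ∈ s, p i) (∑ i ∈ s, α i) := by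
  classical
  induction s using Finset.induction_on with
  | empty => simpa using Lead.one
  | insert a s ha ih => rw [Finset.prod_insert ha, Finset.sum_insert ha]; exact (hp a).mul ih

lemma Lead.X (i : σ) : Lead (X i : MvPolynomial σ T) (Finsupp.single i 1) := by
  unfold Lead
  simp [MvPolynomial.X]

variable (f : σ → MvPolynomial σ T) (M : ℕ)

/-- The triangular basis. -/
def psi [Fintype σ] (α : σ →₀ ℕ) : MvPolynomial σ T := (∏ i, f i ^ (α i / M)) * ∏ i, X i ^ (α i % M)

variable {f M}

lemma Lead_psi [Fintype σ] (hf : ∀ i, Lead (f i) (Finsupp.single i M)) (α : σ →₀ ℕ) :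
    Lead (psi f M α) α := by
  classical
  have h1 := (Lead.prod Finset.univ (fun i => (hf i).pow (α i / M))).mul
    (Lead.prod Finset.univ (fun i => (Lead.X (T := T) i).pow (α i % M)))
  have e : (∑ i, (α i / M) • Finsupp.single i M) + ∑ i, (α i % M) • Finsupp.single i 1 = α := by
    ext j
    simp [Finsupp.single_apply, Nat.div_add_mod']
  rw [e] at h1
  exact h1

/-- the triangular map. -/
def Phi [Fintype σ] (f : σ → MvPolynomial σ T) (M : ℕ) : ((σ →₀ ℕ) →₀ T) →ₗ[T] MvPolynomial σ T :=
  Finsupp.linearCombination T (psi f M)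

lemma Phi_inj [Fintype σ] (hf : ∀ i, Lead (f i) (Finsupp.single i M)) : Function.Injective (Phi f M) := by
  classical
  rw [← LinearMap.ker_eq_bot, LinearMap.ker_eq_bot']
  intro u hu
  by_contra hne
  obtain ⟨α, hα, hmax⟩ := Finset.exists_max_image u.support (fun α => α.degree)
    (Finsupp.support_nonempty_iff.mpr hne)
  have h0 : coeff α (Phi f M u) = 0 := by rw [hu]; simp
  rw [Phi, Finsupp.linearCombination_apply, Finsupp.sum, coeff_sum,
    Finset.sum_eq_single α] at h0
  · have := Lead_psi hf α α le_rfl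
    simp [coeff_monomial, sub_eq_zero] at this
    simp [this] at h0
    simp [h0] at hα
  · intro β hβ hβα
    have := Lead_psi hf β α (hmax β hβ)
    simp [coeff_monomial, sub_eq_zero, hβα] at this
    simp [this]
  · intro h; exact absurd hα h

lemma Phi_surj [Fintype σ] (hf : ∀ i, Lead (f i) (Finsupp.single i M)) : Function.Surjective (Phi f M) := by
  classical
  have key : ∀ k, Low T σ k ≤ LinearMap.range (Phi f M) := by
    intro k
    induction k with
    | zero =>
      intro p hp
      have : p = 0 := by ext β; simpa using hp β (Nat.zero_le _)
      rw [this]; exact Submodule.zero_mem _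
    | succ k ih =>
      intro p hp
      have e : p = Phi f M (Finsupp.onFinset p.support (fun α => coeff α p) (by simp)) -
          ∑ α ∈ p.support, coeff α p • (psi f M α - monomial α 1) := by
        rw [Phi, Finsupp.linearCombination_apply, Finsupp.onFinset_sum _ (by simp)]
        simp only [smul_sub, Finset.sum_sub_distrib]
        rw [sub_sub_cancel]
        conv_lhs => rw [p.as_sum]
        refine Finset.sum_congr rfl fun α _ => ?_
        rw [smul_monomial, smul_eq_mul, mul_one]
      rw [e]
      refine Submodule.sub_mem _ ⟨_, rfl⟩ (ih ?_)
      refine Submodule.sum_mem _ fun α hα => Submodule.smul_mem _ _ ?_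
      refine Low_mono ?_ (Lead_psi hf α)
      by_contra hlt
      exact (mem_support_iff.mp hα) (hp α (by omega))
  intro p
  obtain ⟨u, hu⟩ := key (p.totalDegree + 1) (x := p) (by
    intro β hβ
    apply coeff_eq_zero_of_totalDegree_lt
    exact hβ)
  exact ⟨u, hu⟩

/-- torsion-freeness of the quotient by `f`. -/
lemma torsion_free_quot [Fintype σ] [IsDomain T] (hM : 0 < M)
    (hf : ∀ i, Lead (f i) (Finsupp.single i M)) (τ : T) (hτ : τ ≠ 0)
    (e : MvPolynomial σ T) (he : C τ * e ∈ Ideal.span (Set.range f)) :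
    e ∈ Ideal.span (Set.range f) := by
  classical
  let S : Set (σ →₀ ℕ) := {α | ∃ i, M ≤ α i}
  have hsub : ∀ u ∈ Finsupp.supported T T S, Phi f M u ∈ Ideal.span (Set.range f) := by
    intro u hu
    rw [Phi, Finsupp.linearCombination_apply]
    refine Submodule.sum_mem _ fun α hα => ?_
    obtain ⟨i, hi⟩ := hu hα
    simp only [smul_eq_C_mul]
    apply Ideal.mul_mem_left
    apply Ideal.mul_mem_right
    rw [← Finset.mul_prod_erase _ _ (Finset.mem_univ i)]
    apply Ideal.mul_mem_right
    exact Ideal.pow_mem_of_mem _ (Ideal.subset_span (Set.mem_range_self i)) _ (Nat.div_pos hi hM)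
  have hsup : ∀ p ∈ Ideal.span (Set.range f), ∃ u ∈ Finsupp.supported T T S, Phi f M u = p := by
    have hmul : ∀ (i : σ) (w : (σ →₀ ℕ) →₀ T),
        Phi f M w * f i ∈ (Finsupp.supported T T S).map (Phi f M) := by
      intro i w
      induction w using Finsupp.induction_linear with
      | zero => simp
      | add u v hu hv => rw [map_add, add_mul]; exact Submodule.add_mem _ hu hv
      | single α c =>
        refine ⟨Finsupp.single (α + Finsupp.single i M) c,
          Finsupp.single_mem_supported T c (show _ ∈ S from ⟨i, by simp⟩), ?_⟩
        simp only [Phi, Finsupp.linearCombination_single, psi, smul_mul_assoc]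
        congr 1
        have h1 : ∏ k, (X k : MvPolynomial σ T) ^ ((α + Finsupp.single i M) k % M)
            = ∏ k, X k ^ (α k % M) := by
          refine Finset.prod_congr rfl fun k _ => ?_
          by_cases h : i = k
          · subst h; simp
          · simp [h]
        have h2 : ∏ k, f k ^ ((α + Finsupp.single i M) k / M)
            = (∏ k, f k ^ (α k / M)) * f i := by
          rw [← Finset.mul_prod_erase _ _ (Finset.mem_univ i),
            ← Finset.mul_prod_erase (a := i) _ (fun k => f k ^ (α k / M)) (Finset.mem_univ i)]
          have h3 : ∏ k ∈ Finset.univ.erase i, f k ^ ((α + Finsupp.single i M) k / M) =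
              ∏ k ∈ Finset.univ.erase i, f k ^ (α k / M) := by
            refine Finset.prod_congr rfl fun k hk => ?_
            have h : i ≠ k := (Finset.ne_of_mem_erase hk).symm
            simp [h]
          rw [h3]
          simp [Nat.add_div_right _ hM, pow_succ]
          ring
        rw [h1, h2]; ring
    intro p hp
    obtain ⟨c, rfl⟩ := Ideal.mem_span_range_iff_exists_fun.mp hp
    have : ∑ i, c i * f i ∈ (Finsupp.supported T T S).map (Phi f M) := by
      refine Submodule.sum_mem _ fun i _ => ?_
      obtain ⟨w, hw⟩ := Phi_surj hf (c i)
      rw [← hw]; exact hmul i w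
    exact this
  obtain ⟨u, rfl⟩ := Phi_surj hf e
  obtain ⟨v, hv, hv'⟩ := hsup _ he
  have : v = τ • u := by
    apply Phi_inj hf
    rw [hv', map_smul, smul_eq_C_mul]
  apply hsub
  intro α hα
  apply hv
  rw [this]
  simpa [hτ] using hα

end Free
end PF

end

section

namespace PF

/-! ### Finitely generated modules over `ℂ[X]` and their specializations -/

lemma pid_spec (M : Type) [AddCommGroup M] [Module (Polynomial ℂ) M] [Module ℂ M]
    [IsScalarTower ℂ (Polynomial ℂ) M] [Module.Finite (Polynomial ℂ) M] :
    ∃ r : ℕ, (∀ (a : ℂ) (V : Type) [AddCommGroup V] [Module ℂ V] [Module.Finite ℂ V]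
      (π : M →ₗ[ℂ] V), Function.Surjective π →
      (∀ m, π m = 0 ↔ ∃ m', m = (Polynomial.X - Polynomial.C a) • m') →
      r ≤ Module.finrank ℂ V ∧ (Module.finrank ℂ V = r ↔
        ∀ m : M, (Polynomial.X - Polynomial.C a) • m = 0 → m = 0)) ∧
      ∃ a : ℂ, ∀ m : M, (Polynomial.X - Polynomial.C a) • m = 0 → m = 0 := by
  classical
  let N := Submodule.torsion (Polynomial ℂ) M
  have hNfg : N.FG := IsNoetherian.noetherian N
  haveI : Module.Finite (Polynomial ℂ) N := Module.Finite.iff_fg.mpr hNfg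
  haveI : Module.Free (Polynomial ℂ) (M ⧸ N) := Module.free_of_finite_type_torsion_free'
  let b := Module.Free.chooseBasis (Polynomial ℂ) (M ⧸ N)
  obtain ⟨p, hp0, hp⟩ : ∃ p : Polynomial ℂ, p ≠ 0 ∧ ∀ n ∈ N, p • n = 0 := by
    have := Submodule.annihilator_top_inter_nonZeroDivisors
      (R := Polynomial ℂ) (M := N) (Submodule.torsion_isTorsion)
    obtain ⟨p, hp1, hp2⟩ := this
    refine ⟨p, nonZeroDivisors.ne_zero hp2, fun n hn => ?_⟩
    have := Submodule.mem_annihilator.mp hp1 ⟨n, hn⟩ trivial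
    simpa using congrArg Subtype.val this
  have hxa : ∀ a : ℂ, (Polynomial.X - Polynomial.C a : Polynomial ℂ) ≠ 0 :=
    fun a => Polynomial.X_sub_C_ne_zero a
  have hprime : ∀ a : ℂ, Prime (Polynomial.X - Polynomial.C a : Polynomial ℂ) :=
    fun a => Polynomial.prime_X_sub_C a
  have hNtor : ∀ (a : ℂ) (m : M), (Polynomial.X - Polynomial.C a) • m ∈ N → m ∈ N := by
    intro a m hm
    rw [Submodule.mem_torsion_iff] at hm ⊢
    obtain ⟨c, hc⟩ := hm
    refine ⟨c * ⟨_, mem_nonZeroDivisors_of_ne_zero (hxa a)⟩, ?_⟩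
    rw [mul_smul]; exact hc
  refine ⟨Fintype.card (Module.Free.ChooseBasisIndex (Polynomial ℂ) (M ⧸ N)), ?_, ?_⟩
  · intro a V _ _ _ π hπ hker
    let x : Polynomial ℂ := Polynomial.X - Polynomial.C a
    let ψ : M →ₗ[ℂ] (Module.Free.ChooseBasisIndex (Polynomial ℂ) (M ⧸ N) → ℂ) :=
      { toFun := fun m i => Polynomial.eval a (b.repr (N.mkQ m) i)
        map_add' := by intro m m'; ext i; simp
        map_smul' := by
          intro c m; ext i
          have : c • m = (Polynomial.C c) • m := by
            rw [← Polynomial.algebraMap_eq, algebraMap_smul]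
          rw [this]; simp }
    have hψs : Function.Surjective ψ := by
      intro v
      obtain ⟨m, hm⟩ := N.mkQ_surjective (b.equivFun.symm fun i => Polynomial.C (v i))
      refine ⟨m, ?_⟩
      ext i
      simp only [ψ, LinearMap.coe_mk, AddHom.coe_mk, hm]
      have := congrFun (b.equivFun.apply_symm_apply fun i => Polynomial.C (v i)) i
      rw [Module.Basis.equivFun_apply] at this
      rw [this]; simp
    have hle : LinearMap.ker π ≤ LinearMap.ker ψ := by
      intro m hm
      obtain ⟨m', rfl⟩ := (hker m).mp hm
      ext i
      simp [ψ]
    have hψker : ∀ m, ψ m = 0 → ∃ m', m - x • m' ∈ N := by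
      intro m hm
      have hdiv : ∀ i, x ∣ b.repr (N.mkQ m) i := fun i =>
        Polynomial.dvd_iff_isRoot.mpr (congrFun hm i)
      choose q hq using hdiv
      obtain ⟨m', hm'⟩ := N.mkQ_surjective (b.equivFun.symm q)
      refine ⟨m', ?_⟩
      rw [← Submodule.ker_mkQ N, LinearMap.mem_ker, map_sub, map_smul, hm', sub_eq_zero]
      apply b.equivFun.injective
      rw [map_smul, LinearEquiv.apply_symm_apply]
      ext1 i
      simpa using hq i
    let ψb : V →ₗ[ℂ] (Module.Free.ChooseBasisIndex (Polynomial ℂ) (M ⧸ N) → ℂ) :=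
      ((LinearMap.ker π).liftQ ψ hle).comp (π.quotKerEquivOfSurjective hπ).symm.toLinearMap
    have hψb : ∀ m, ψb (π m) = ψ m := by
      intro m
      have : (π.quotKerEquivOfSurjective hπ).symm (π m) = (LinearMap.ker π).mkQ m := by
        rw [LinearEquiv.symm_apply_eq]; rfl
      simp only [ψb, LinearMap.comp_apply, LinearEquiv.coe_coe, this]
      rfl
    have hψbs : Function.Surjective ψb := by
      intro v
      obtain ⟨m, rfl⟩ := hψs v
      exact ⟨π m, hψb m⟩
    have hr := LinearMap.finrank_le_finrank_of_surjective hψbs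
    rw [Module.finrank_fintype_fun_eq_card] at hr
    refine ⟨hr, ?_⟩
    have hinj : Module.finrank ℂ V = Fintype.card (Module.Free.ChooseBasisIndex (Polynomial ℂ) (M ⧸ N))
        ↔ Function.Injective ψb := by
      rw [← Module.finrank_fintype_fun_eq_card ℂ]
      constructor
      · intro h
        exact (LinearMap.injective_iff_surjective_of_finrank_eq_finrank h).mpr hψbs
      · intro h
        exact (LinearEquiv.ofBijective ψb ⟨h, hψbs⟩).finrank_eq
    rw [hinj]
    constructor
    · intro h
      have hN : N ≤ Ideal.span {x} • N := by
        intro n hn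
        have h1 : ψ n = 0 := by
          ext i
          have : N.mkQ n = 0 := by simpa using hn
          simp only [ψ, LinearMap.coe_mk, AddHom.coe_mk, this]
          simp
        rw [← hψb] at h1
        have h2 : π n = 0 := h (by rw [h1, map_zero])
        obtain ⟨m', hm'⟩ := (hker n).mp h2
        rw [hm']
        exact Submodule.smul_mem_smul (Ideal.mem_span_singleton_self x)
          (hNtor a m' (hm' ▸ hn))
      obtain ⟨s, hs, hsN⟩ :=
        Submodule.exists_sub_one_mem_and_smul_eq_zero_of_fg_of_le_smul _ N hNfg hN
      intro m hm
      have hmN : m ∈ N := hNtor a m (by rw [hm]; exact Submodule.zero_mem _)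
      obtain ⟨q, hq⟩ := Ideal.mem_span_singleton'.mp hs
      have : m = s • m - (q * x) • m := by rw [hq]; simp [sub_smul]
      rw [this, hsN m hmN, mul_smul]
      simp [x, hm]
    · intro h
      rw [← LinearMap.ker_eq_bot, LinearMap.ker_eq_bot']
      intro v hv
      obtain ⟨m, rfl⟩ := hπ v
      rw [hψb] at hv
      obtain ⟨m', hm'⟩ := hψker m hv
      -- N = x N
      obtain ⟨k, p', hp', hpk⟩ : ∃ (k : ℕ) (p' : Polynomial ℂ), ¬ x ∣ p' ∧ p = x ^ k * p' := by
        have hfin : FiniteMultiplicity x p :=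
          FiniteMultiplicity.of_not_isUnit (hprime a).not_unit hp0
        obtain ⟨c, hc, hc'⟩ := hfin.exists_eq_pow_mul_and_not_dvd
        exact ⟨_, c, hc', hc⟩
      have hxk : ∀ (k : ℕ) (n : M), x ^ k • n = 0 → n = 0 := by
        intro k
        induction k with
        | zero => intro n hn; simpa using hn
        | succ k ih =>
          intro n hn
          rw [pow_succ', mul_smul] at hn
          exact ih n (h _ hn)
      have hp'N : p' • (m - x • m') = 0 := by
        apply hxk k
        rw [smul_smul, ← hpk, hp _ hm']
      have hcop : IsCoprime x p' := ((hprime a).irreducible.coprime_iff_not_dvd).mpr hp'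
      obtain ⟨u, w, huw⟩ := hcop
      rw [hker]
      refine ⟨m' + u • (m - x • m'), ?_⟩
      have : m - x • m' = x • (u • (m - x • m')) := by
        conv_lhs => rw [← one_smul (Polynomial ℂ) (m - x • m'), ← huw, add_smul, mul_smul w, hp'N]
        rw [smul_zero, add_zero, mul_comm, mul_smul]
      rw [smul_add]
      change m = x • m' + x • u • (m - x • m')
      rw [← this]; abel
  · obtain ⟨a, ha⟩ : ∃ a : ℂ, ¬ p.IsRoot a := by
      by_contra! h
      exact hp0 (Polynomial.funext fun a => by simpa using h a)
    refine ⟨a, fun m hm => ?_⟩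
    have hmN : m ∈ N := hNtor a m (by rw [hm]; exact Submodule.zero_mem _)
    have hcop : IsCoprime (Polynomial.X - Polynomial.C a) p :=
      ((hprime a).irreducible.coprime_iff_not_dvd).mpr
        (fun h => ha (Polynomial.dvd_iff_isRoot.mp h))
    obtain ⟨u, w, huw⟩ := hcop
    rw [← one_smul (Polynomial ℂ) m, ← huw, add_smul, mul_smul, mul_smul, hm, hp m hmN]
    simp
end PF

end

section

namespace PF

/-! ### Truncated colengths -/

lemma fin_quot {T σ : Type*} [CommRing T] [Finite σ] (I : Ideal (MvPolynomial σ T)) (N : ℕ) :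
    Module.Finite T (MvPolynomial σ T ⧸ (I ⊔ idealOfVars σ T ^ N)) := by
  classical
  refine ⟨⟨(Finsupp.finite_of_degree_lt (σ := σ) N).toFinset.image
    (fun α => Ideal.Quotient.mk _ (monomial α 1)), eq_top_iff.mpr ?_⟩⟩
  intro x _
  obtain ⟨p, rfl⟩ := Ideal.Quotient.mk_surjective x
  rw [p.as_sum, map_sum]
  refine Submodule.sum_mem _ fun α _ => ?_
  by_cases h : α.degree < N
  · have : monomial α (coeff α p) = coeff α p • monomial α (1 : T) := by
      rw [smul_monomial, smul_eq_mul, mul_one]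
    rw [this]
    have h2 : (Ideal.Quotient.mk (I ⊔ idealOfVars σ T ^ N)) (coeff α p • monomial α (1 : T)) =
      coeff α p • (Ideal.Quotient.mk (I ⊔ idealOfVars σ T ^ N)) (monomial α (1 : T)) := rfl
    rw [h2]
    refine Submodule.smul_mem _ _ (Submodule.subset_span ?_)
    simp only [Finset.coe_image, Set.Finite.coe_toFinset]
    exact ⟨α, h, rfl⟩
  · have : (Ideal.Quotient.mk (I ⊔ idealOfVars σ T ^ N)) (monomial α (coeff α p)) = 0 := by
      rw [Ideal.Quotient.eq_zero_iff_mem]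
      refine Ideal.mem_sup_right ?_
      rw [mem_pow_idealOfVars_iff']
      intro x hx
      rw [coeff_monomial, if_neg]
      rintro rfl; exact h hx
    rw [this]; exact Submodule.zero_mem _

variable {σ : Type} [Finite σ]

def DD (N : ℕ) (I : Ideal (MvPolynomial σ ℂ)) : ℕ :=
  Module.finrank ℂ (MvPolynomial σ ℂ ⧸ (I ⊔ idealOfVars σ ℂ ^ N))

lemma finrank_quot_le {A : Type*} [CommRing A] [Algebra ℂ A] {I J : Ideal A} (h : I ≤ J)
    [Module.Finite ℂ (A ⧸ I)] : Module.finrank ℂ (A ⧸ J) ≤ Module.finrank ℂ (A ⧸ I) :=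
  LinearMap.finrank_le_finrank_of_surjective
    (f := (Ideal.Quotient.factorₐ ℂ h).toLinearMap) (Ideal.Quotient.factor_surjective h)

lemma eq_of_finrank_quot {A : Type*} [CommRing A] [Algebra ℂ A] {I J : Ideal A} (h : I ≤ J)
    [Module.Finite ℂ (A ⧸ I)] (he : Module.finrank ℂ (A ⧸ I) = Module.finrank ℂ (A ⧸ J)) :
    I = J := by
  refine le_antisymm h fun x hx => ?_
  have hs : Function.Surjective (Ideal.Quotient.factorₐ ℂ h).toLinearMap :=
    Ideal.Quotient.factor_surjective h
  have : Module.Finite ℂ (A ⧸ J) := Module.Finite.of_surjective _ hs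
  have hi := (LinearMap.injective_iff_surjective_of_finrank_eq_finrank he).mpr hs
  rw [← Ideal.Quotient.eq_zero_iff_mem]
  apply hi
  rw [map_zero]
  change Ideal.Quotient.mk J x = 0
  rwa [Ideal.Quotient.eq_zero_iff_mem]

lemma DD_mono (I : Ideal (MvPolynomial σ ℂ)) {k l : ℕ} (h : k ≤ l) : DD k I ≤ DD l I := by
  have := fin_quot I l
  exact finrank_quot_le (sup_le_sup_left (Ideal.pow_le_pow_right h) I)

lemma DD_stab (I : Ideal (MvPolynomial σ ℂ)) (k : ℕ) (h : DD k I = DD (k+1) I) :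
    I ⊔ idealOfVars σ ℂ ^ k = I ⊔ idealOfVars σ ℂ ^ (k+1) := by
  have := fin_quot I (k+1)
  exact (eq_of_finrank_quot (sup_le_sup_left (Ideal.pow_le_pow_right (Nat.le_succ k)) I) h.symm).symm

lemma stab_ge {A : Type*} [CommRing A] (I J : Ideal A) {N : ℕ}
    (h : I ⊔ J ^ N = I ⊔ J ^ (N+1)) {k : ℕ} (hk : N ≤ k) : I ⊔ J ^ k = I ⊔ J ^ N := by
  induction k, hk using Nat.le_induction with
  | base => rfl
  | succ k hk ih =>
    rw [← ih]
    refine le_antisymm (sup_le_sup_left (Ideal.pow_le_pow_right (Nat.le_succ k)) I) ?_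
    refine sup_le le_sup_left ?_
    have h1 : J ^ N ≤ I ⊔ J ^ (N+1) := h ▸ le_sup_right
    calc J ^ k = J ^ (k - N) * J ^ N := by rw [← pow_add]; congr 1; omega
      _ ≤ J ^ (k - N) * (I ⊔ J ^ (N+1)) := Ideal.mul_mono_right h1
      _ = J ^ (k - N) * I ⊔ J ^ (k - N) * J ^ (N+1) := Ideal.mul_sup _ _ _
      _ ≤ I ⊔ J ^ (k+1) := by
        refine sup_le_sup Ideal.mul_le_right (le_of_eq ?_)
        rw [← pow_add]; congr 1; omega

def HasMu (I : Ideal (MvPolynomial σ ℂ)) (v : ℕ) : Prop :=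
  ∃ N, I ⊔ idealOfVars σ ℂ ^ N = I ⊔ idealOfVars σ ℂ ^ (N+1) ∧ DD N I = v

lemma HasMu.eventually {I : Ideal (MvPolynomial σ ℂ)} {v : ℕ} (h : HasMu I v) :
    ∃ N0, ∀ N, N0 ≤ N → (I ⊔ idealOfVars σ ℂ ^ N = I ⊔ idealOfVars σ ℂ ^ (N+1) ∧ DD N I = v) := by
  obtain ⟨N, hN, hv⟩ := h
  refine ⟨N, fun k hk => ⟨?_, ?_⟩⟩
  · rw [stab_ge _ _ hN hk, stab_ge _ _ hN (k := k+1) (by omega)]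
  · rw [← hv, DD, DD, stab_ge _ _ hN hk]

lemma HasMu.unique {I : Ideal (MvPolynomial σ ℂ)} {v w : ℕ} (h : HasMu I v) (h' : HasMu I w) :
    v = w := by
  obtain ⟨N, hN⟩ := h.eventually
  obtain ⟨M, hM⟩ := h'.eventually
  rw [← (hN (max N M) (le_max_left _ _)).2, (hM (max N M) (le_max_right _ _)).2]

lemma HasMu.DD_le {I : Ideal (MvPolynomial σ ℂ)} {v : ℕ} (h : HasMu I v) (N : ℕ) :
    DD N I ≤ v := by
  obtain ⟨M, hM⟩ := h.eventually
  rw [← (hM (max N M) (le_max_right _ _)).2]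
  exact DD_mono I (le_max_left _ _)

lemma HasMu.of_lt {I : Ideal (MvPolynomial σ ℂ)} {N : ℕ} (h : DD N I < N) : HasMu I (DD N I) := by
  obtain ⟨k, hk, hkk⟩ : ∃ k < N, DD k I = DD (k+1) I := by
    by_contra! hc
    have : ∀ k, k ≤ N → k ≤ DD k I := by
      intro k
      induction k with
      | zero => intro _; omega
      | succ k ih =>
        intro hk
        have h1 := ih (by omega)
        have h2 := hc k (by omega)
        have h3 := DD_mono I (Nat.le_succ k)
        simp only [Nat.succ_eq_add_one] at h3
        omega
    have := this N le_rfl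
    omega
  have hs := DD_stab I k hkk
  refine ⟨k, hs, ?_⟩
  rw [DD, DD, stab_ge _ _ hs (k := N) (by omega)]

lemma HasMu.of_pow_le {I : Ideal (MvPolynomial σ ℂ)} {N : ℕ}
    (h : I ⊔ idealOfVars σ ℂ ^ N = I ⊔ idealOfVars σ ℂ ^ (N+1)) : HasMu I (DD N I) := ⟨N, h, rfl⟩

/-! ### Comparison with power series -/

lemma ps_mem (N : ℕ) (f : MvPowerSeries σ ℂ) (hf : ∀ x, Finsupp.degree x < N → f.coeff x = 0) :
    f ∈ (idealOfVars σ ℂ ^ N).map (coeToMvPowerSeries.ringHom (σ := σ) (R := ℂ)) := by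
  classical
  have hch : ∀ β : σ →₀ ℕ, ∃ α : σ →₀ ℕ, N ≤ β.degree → α ≤ β ∧ α.degree = N := by
    intro β
    by_cases h : N ≤ β.degree
    · obtain ⟨α, h1, h2⟩ := Finsupp.exists_le_degree_eq β N h
      exact ⟨α, fun _ => ⟨h1, h2⟩⟩
    · exact ⟨0, fun h' => absurd h' h⟩
  choose ch hch using hch
  let g : (σ →₀ ℕ) → MvPowerSeries σ ℂ := fun α γ => if ch (γ + α) = α then f.coeff (γ + α) else 0
  have hg : ∀ α γ, (g α).coeff γ = if ch (γ + α) = α then f.coeff (γ + α) else 0 := fun α γ => rfl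
  have : f = ∑ α ∈ (Finsupp.finite_of_degree_eq (σ := σ) N).toFinset,
      g α * MvPowerSeries.monomial α 1 := by
    ext β
    rw [map_sum]
    simp only [MvPowerSeries.coeff_mul_monomial, mul_one, hg]
    by_cases hb : N ≤ β.degree
    · rw [Finset.sum_eq_single (ch β)]
      · rw [if_pos (hch β hb).1, tsub_add_cancel_of_le (hch β hb).1, if_pos rfl]
      · intro α _ hα
        split_ifs with h1 h2
        · rw [tsub_add_cancel_of_le h1] at h2
          exact absurd h2.symm hα
        · rfl
        · rfl
      · intro h
        exact absurd (by simpa using (hch β hb).2) h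
    · rw [hf β (not_le.mp hb)]
      symm
      apply Finset.sum_eq_zero
      intro α hα
      have hα' : α.degree = N := by simpa using hα
      rw [if_neg]
      intro hle
      exact hb (hα' ▸ Finsupp.degree_mono hle)
  rw [this]
  refine Ideal.sum_mem _ fun α hα => Ideal.mul_mem_left _ _ ?_
  have hα' : α.degree = N := by simpa using hα
  have : MvPowerSeries.monomial α (1 : ℂ) = coeToMvPowerSeries.ringHom (monomial α (1 : ℂ)) := by
    simp
  rw [this]
  exact Ideal.mem_map_of_mem _ ((monomial_mem_pow_idealOfVars_iff N α one_ne_zero).mpr hα'.ge)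

lemma HasMu.finrank_ps {gs : Set (MvPolynomial σ ℂ)} {v : ℕ} (h : HasMu (Ideal.span gs) v) :
    Module.finrank ℂ (MvPowerSeries σ ℂ ⧸ Ideal.span
      ((fun g => (coeToMvPowerSeries.ringHom g : MvPowerSeries σ ℂ)) '' gs)) = v := by
  classical
  obtain ⟨N, hN, hv⟩ := h
  set I := Ideal.span gs with hI
  set cc := (coeToMvPowerSeries.ringHom (σ := σ) (R := ℂ)) with hcc
  have hIm : Ideal.span ((fun g => cc g) '' gs) = I.map cc := by
    rw [hI, Ideal.map_span]
  rw [hIm]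
  set mh := (idealOfVars σ ℂ).map cc with hmh
  have hmax : mh ≤ IsLocalRing.maximalIdeal (MvPowerSeries σ ℂ) := by
    rw [hmh, Ideal.map_span, Ideal.span_le]
    rintro _ ⟨_, ⟨i, rfl⟩, rfl⟩
    simp [hcc, MvPowerSeries.isUnit_iff_constantCoeff]
  have hle : mh ^ N ≤ I.map cc := by
    have h1 : mh ^ N ≤ I.map cc ⊔ mh * mh ^ N := by
      rw [← pow_succ', hmh, ← Ideal.map_pow, ← Ideal.map_pow, ← Ideal.map_sup, ← hN]
      exact Ideal.map_mono le_sup_right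
    have hfg : (mh ^ N).FG := IsNoetherian.noetherian _
    exact Submodule.le_of_le_smul_of_le_jacobson_bot hfg
      (by rw [IsLocalRing.jacobson_eq_maximalIdeal ⊥ bot_ne_top]; exact hmax) h1
  let q : MvPowerSeries σ ℂ →ₐ[ℂ] MvPolynomial σ ℂ ⧸ (I ⊔ idealOfVars σ ℂ ^ N) :=
    (Ideal.Quotient.factorₐ ℂ (le_sup_right : idealOfVars σ ℂ ^ N ≤ I ⊔ idealOfVars σ ℂ ^ N)).comp
      ((MvPowerSeries.truncTotalAlgHom σ ℂ N).restrictScalars ℂ)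
  have hq : ∀ f, q f = Ideal.Quotient.mk _ (MvPowerSeries.truncTotal N f) := fun f => rfl
  have hqc : ∀ p, q (cc p) = Ideal.Quotient.mk _ p := by
    intro p
    rw [hq, Ideal.Quotient.eq]
    refine Ideal.mem_sup_right ?_
    rw [mem_pow_idealOfVars_iff']
    intro x hx
    rw [coeff_sub, MvPowerSeries.coeff_truncTotal _ hx]
    simp [hcc]
  have hqs : Function.Surjective q := by
    intro x
    obtain ⟨p, rfl⟩ := Ideal.Quotient.mk_surjective x
    exact ⟨_, hqc p⟩
  have hker : RingHom.ker q = I.map cc := by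
    apply le_antisymm
    · intro f hf
      rw [RingHom.mem_ker, hq, Ideal.Quotient.eq_zero_iff_mem] at hf
      have h1 := Ideal.mem_map_of_mem cc hf
      rw [Ideal.map_sup, Ideal.map_pow] at h1
      have h2 := (sup_le le_rfl hle) h1
      have h3 : f - cc (MvPowerSeries.truncTotal N f) ∈ I.map cc := by
        apply hle
        rw [hmh, ← Ideal.map_pow]
        apply ps_mem
        intro x hx
        rw [map_sub, hcc]
        simp [MvPowerSeries.coeff_truncTotal _ hx]
      simpa using Ideal.add_mem _ h3 h2
    · rw [Ideal.map_le_iff_le_comap]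
      intro p hp
      rw [Ideal.mem_comap, RingHom.mem_ker, hqc, Ideal.Quotient.eq_zero_iff_mem]
      exact Ideal.mem_sup_left hp
  rw [← hv, DD, ← hker]
  exact (Ideal.quotientKerAlgEquivOfSurjective hqs).toLinearEquiv.finrank_eq

end PF

end

section

namespace PF
set_option linter.unusedSectionVars false
/-! ### Families over `ℂ[X]` and local triviality -/

lemma nak {A : Type*} [CommRing A] (J K L : Ideal A) (hL : L.FG) (h : L ≤ K ⊔ J * L) :
    ∃ g, g - 1 ∈ J ∧ ∀ x ∈ L, g * x ∈ K := by
  have h1 : Submodule.map K.mkQ L ≤ J • Submodule.map K.mkQ L := by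
    rw [← Submodule.map_smul'']
    refine (Submodule.map_mono h).trans ?_
    rw [Submodule.map_sup, Submodule.mkQ_map_self, bot_sup_eq]
    exact le_rfl
  obtain ⟨g, hg, hg'⟩ := Submodule.exists_sub_one_mem_and_smul_eq_zero_of_fg_of_le_smul J
    (Submodule.map K.mkQ L) (Submodule.FG.map _ hL) h1
  refine ⟨g, hg, fun x hx => ?_⟩
  have := hg' _ (Submodule.mem_map_of_mem hx)
  rw [← map_smul, Submodule.mkQ_apply, Submodule.Quotient.mk_eq_zero] at this
  exact this

variable {σ : Type} [Fintype σ]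

/-- specialization at `t` -/
def sp (t : ℂ) : MvPolynomial σ (Polynomial ℂ) →ₐ[ℂ] MvPolynomial σ ℂ :=
  MvPolynomial.mapAlgHom (Polynomial.aeval t)

/-- evaluation at the point `(0,t)` -/
def evq (t : ℂ) : MvPolynomial σ (Polynomial ℂ) →+* ℂ :=
  (Polynomial.evalRingHom t).comp constantCoeff

def Triv (f : σ → MvPolynomial σ (Polynomial ℂ)) (t : ℂ) : Prop :=
  ∃ g N, evq t g ≠ 0 ∧ ∀ x ∈ idealOfVars σ (Polynomial ℂ) ^ N, g * x ∈ Ideal.span (Set.range f)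

lemma sp_C (t : ℂ) (p : Polynomial ℂ) : sp (σ := σ) t (C p) = C (p.eval t) := by
  simp [sp]

lemma sp_X (t : ℂ) (i : σ) : sp (σ := σ) t (X i) = X i := by
  simp [sp]

lemma coeff_sp (t : ℂ) (p : MvPolynomial σ (Polynomial ℂ)) (α : σ →₀ ℕ) :
    coeff α (sp t p) = (coeff α p).eval t := by
  simp [sp, mapAlgHom_apply, MvPolynomial.coeff_map]

lemma constCoeff_sp (t : ℂ) (p : MvPolynomial σ (Polynomial ℂ)) :
    constantCoeff (sp t p) = evq t p := by
  rw [constantCoeff_eq, coeff_sp]; rfl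

lemma sp_surj (t : ℂ) : Function.Surjective (sp (σ := σ) t) := by
  intro p
  refine ⟨MvPolynomial.map Polynomial.C p, ?_⟩
  ext α
  rw [coeff_sp, MvPolynomial.coeff_map]; simp

lemma sp_eq_zero {t : ℂ} {p : MvPolynomial σ (Polynomial ℂ)} (h : sp t p = 0) :
    ∃ q, p = C (Polynomial.X - Polynomial.C t) * q := by
  change C (Polynomial.X - Polynomial.C t) ∣ p
  rw [C_dvd_iff_dvd_coeff]
  intro α
  rw [Polynomial.dvd_iff_isRoot, Polynomial.IsRoot, ← coeff_sp, h, coeff_zero]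

lemma sp_xt (t : ℂ) : sp (σ := σ) t (C (Polynomial.X - Polynomial.C t)) = 0 := by
  rw [sp_C]; simp

lemma map_vars (t : ℂ) (N : ℕ) :
    (idealOfVars σ (Polynomial ℂ) ^ N).map (sp t) = idealOfVars σ ℂ ^ N := by
  rw [Ideal.map_pow, Ideal.map_span, ← Set.range_comp]
  congr 3
  ext i : 1
  simp [sp_X]

lemma sub_C_mem {T : Type*} [CommRing T] (p : MvPolynomial σ T) :
    p - C (constantCoeff p) ∈ idealOfVars σ T := by
  rw [← pow_one (idealOfVars σ T), mem_pow_idealOfVars_iff']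
  intro x hx
  have : x = 0 := by rw [← Finsupp.degree_eq_zero_iff]; omega
  subst this
  simp [constantCoeff_eq]

lemma evq_X (t : ℂ) (i : σ) : evq t (X i) = 0 := by simp [evq]
lemma evq_C (t : ℂ) (p : Polynomial ℂ) : evq (σ := σ) t (C p) = p.eval t := by simp [evq]

lemma vars_le_ker (t : ℂ) : idealOfVars σ (Polynomial ℂ) ≤ RingHom.ker (evq t) := by
  rw [Ideal.span_le]; rintro _ ⟨i, rfl⟩; exact evq_X t i

lemma xt_mem_ker (t : ℂ) : C (Polynomial.X - Polynomial.C t) ∈ RingHom.ker (evq (σ := σ) t) := by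
  rw [RingHom.mem_ker, evq_C]; simp

lemma ker_evq_le (t : ℂ) (P : Ideal (MvPolynomial σ (Polynomial ℂ)))
    (h1 : idealOfVars σ (Polynomial ℂ) ≤ P) (h2 : C (Polynomial.X - Polynomial.C t) ∈ P) :
    RingHom.ker (evq t) ≤ P := by
  intro p hp
  have h3 : Polynomial.X - Polynomial.C t ∣ constantCoeff p := by
    rw [Polynomial.dvd_iff_isRoot]; exact hp
  obtain ⟨q, hq⟩ := h3
  have h4 := h1 (sub_C_mem p)
  have h5 : C (constantCoeff p) ∈ P := by
    rw [hq, C_mul]; exact Ideal.mul_mem_right _ _ h2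
  simpa using P.add_mem h4 h5

/-- torsion-freeness at `t` -/
def TF (I : Ideal (MvPolynomial σ (Polynomial ℂ))) (N : ℕ) (t : ℂ) : Prop :=
  ∀ e, C (Polynomial.X - Polynomial.C t) * e ∈ I ⊔ idealOfVars σ (Polynomial ℂ) ^ N →
    e ∈ I ⊔ idealOfVars σ (Polynomial ℂ) ^ N

lemma DD_family (I : Ideal (MvPolynomial σ (Polynomial ℂ))) (N : ℕ) :
    ∃ r, (∀ t, r ≤ DD N (I.map (sp t)) ∧ (DD N (I.map (sp t)) = r ↔ TF I N t)) ∧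
      ∃ a, TF I N a := by
  have := fin_quot I N
  obtain ⟨r, h1, a, h2⟩ := pid_spec
    (MvPolynomial σ (Polynomial ℂ) ⧸ (I ⊔ idealOfVars σ (Polynomial ℂ) ^ N))
  have key : ∀ t, (∀ m : MvPolynomial σ (Polynomial ℂ) ⧸ (I ⊔ idealOfVars σ (Polynomial ℂ) ^ N),
      (Polynomial.X - Polynomial.C t) • m = 0 → m = 0) ↔ TF I N t := by
    intro t
    constructor
    · intro h e he
      rw [← Ideal.Quotient.eq_zero_iff_mem]
      apply h
      rw [← Ideal.Quotient.eq_zero_iff_mem, ← smul_eq_C_mul] at he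
      exact he
    · intro h m hm
      obtain ⟨e, rfl⟩ := Ideal.Quotient.mk_surjective m
      rw [Ideal.Quotient.eq_zero_iff_mem]
      apply h
      rw [← Ideal.Quotient.eq_zero_iff_mem, ← smul_eq_C_mul]
      exact hm
  refine ⟨r, fun t => ?_, a, (key a).mp h2⟩
  rw [← key t]
  have := fin_quot (I.map (sp t)) N
  have hmap : (I ⊔ idealOfVars σ (Polynomial ℂ) ^ N).map (sp t) =
    I.map (sp t) ⊔ idealOfVars σ ℂ ^ N := by rw [Ideal.map_sup, map_vars]
  let π := Ideal.quotientMapₐ (I := I ⊔ idealOfVars σ (Polynomial ℂ) ^ N)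
    (I.map (sp t) ⊔ idealOfVars σ ℂ ^ N) (sp t)
    (by rw [← Ideal.map_le_iff_le_comap, hmap])
  have hπ : ∀ p, π (Ideal.Quotient.mk _ p) = Ideal.Quotient.mk _ (sp t p) := fun p => rfl
  refine h1 t (MvPolynomial σ ℂ ⧸ (I.map (sp t) ⊔ idealOfVars σ ℂ ^ N)) π.toLinearMap ?_ ?_
  · intro x
    obtain ⟨p, rfl⟩ := Ideal.Quotient.mk_surjective x
    obtain ⟨p, rfl⟩ := sp_surj t p
    exact ⟨Ideal.Quotient.mk _ p, hπ p⟩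
  · intro m
    obtain ⟨p, rfl⟩ := Ideal.Quotient.mk_surjective m
    constructor
    · intro h
      have h' : Ideal.Quotient.mk (I.map (sp t) ⊔ idealOfVars σ ℂ ^ N) (sp t p) = 0 := h
      rw [Ideal.Quotient.eq_zero_iff_mem, ← hmap,
        Ideal.mem_map_iff_of_surjective _ (sp_surj t)] at h'
      obtain ⟨y, hy, hyp⟩ := h'
      obtain ⟨q, hq⟩ := sp_eq_zero (t := t) (p := p - y) (by rw [map_sub, hyp, sub_self])
      refine ⟨Ideal.Quotient.mk _ q, ?_⟩
      change _ = Ideal.Quotient.mk _ ((Polynomial.X - Polynomial.C t) • q)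
      rw [smul_eq_C_mul, ← hq, map_sub, Ideal.Quotient.eq_zero_iff_mem.mpr hy, sub_zero]
    · rintro ⟨m', hm'⟩
      obtain ⟨q, rfl⟩ := Ideal.Quotient.mk_surjective m'
      rw [hm']
      change π (Ideal.Quotient.mk _ ((Polynomial.X - Polynomial.C t) • q)) = 0
      rw [hπ, smul_eq_C_mul, map_mul, sp_xt, zero_mul, map_zero]

lemma elim_unit (I : Ideal (MvPolynomial σ (Polynomial ℂ))) (N : ℕ) (t : ℂ)
    (b e : MvPolynomial σ (Polynomial ℂ)) (hb : evq t b ≠ 0)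
    (h1 : b * e ∈ I ⊔ idealOfVars σ (Polynomial ℂ) ^ N)
    (h2 : C (Polynomial.X - Polynomial.C t) * e ∈ I ⊔ idealOfVars σ (Polynomial ℂ) ^ N) :
    e ∈ I ⊔ idealOfVars σ (Polynomial ℂ) ^ N := by
  set K := I ⊔ idealOfVars σ (Polynomial ℂ) ^ N
  let L : Ideal (MvPolynomial σ (Polynomial ℂ)) :=
    Submodule.comap (LinearMap.toSpanSingleton _ _ e) K
  have hL : ∀ x, x ∈ L ↔ x * e ∈ K := fun x => Iff.rfl
  have : L = ⊤ := by
    by_contra hne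
    obtain ⟨P, hP, hLP⟩ := Ideal.exists_le_maximal L hne
    have hv : idealOfVars σ (Polynomial ℂ) ≤ P := by
      have : idealOfVars σ (Polynomial ℂ) ^ N ≤ P := fun x hx =>
        hLP ((hL x).mpr (Ideal.mul_mem_right _ _ (Ideal.mem_sup_right hx)))
      exact hP.isPrime.le_of_pow_le this
    have hk := ker_evq_le t P hv (hLP ((hL _).mpr h2))
    have h3 : b - C (Polynomial.C (evq t b)) ∈ P := hk (by
      rw [RingHom.mem_ker, map_sub, evq_C]; simp)
    have h4 : C (Polynomial.C (evq t b)) ∈ P := by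
      have := P.sub_mem (hLP ((hL b).mpr h1)) h3
      simpa using this
    have hu : IsUnit (C (Polynomial.C (evq t b)) : MvPolynomial σ (Polynomial ℂ)) :=
      ((isUnit_iff_ne_zero.mpr hb).map Polynomial.C).map C
    exact hP.ne_top (Ideal.eq_top_of_isUnit_mem _ h4 hu)
  have := (hL 1).mp (this ▸ trivial)
  simpa using this

lemma Triv.TF {f : σ → MvPolynomial σ (Polynomial ℂ)} {t : ℂ}
    {g : MvPolynomial σ (Polynomial ℂ)} {N : ℕ} (hg : evq t g ≠ 0)
    (hgN : ∀ x ∈ idealOfVars σ (Polynomial ℂ) ^ N, g * x ∈ Ideal.span (Set.range f)) :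
    TF (Ideal.span (Set.range f)) N t := by
  intro e he
  set I := Ideal.span (Set.range f) with hI
  obtain ⟨M, hNM, hM⟩ : ∃ M, N + 1 ≤ M ∧ ∀ i, (f i).totalDegree < M :=
    ⟨N + 1 + ∑ i, (f i).totalDegree, by omega, fun i => by
      have := Finset.single_le_sum (f := fun i => (f i).totalDegree) (fun _ _ => Nat.zero_le _)
        (Finset.mem_univ i)
      omega⟩
  let f' : σ → MvPolynomial σ (Polynomial ℂ) := fun i => f i + X i ^ M
  have hlead : ∀ i, Lead (f' i) (Finsupp.single i M) := by
    intro i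
    have h1 : f' i - monomial (Finsupp.single i M) 1 = f i := by
      simp [f', X_pow_eq_monomial]
    rw [Lead, h1]
    intro α hα
    apply coeff_eq_zero_of_totalDegree_lt
    rw [Finsupp.degree_single] at hα
    exact lt_of_lt_of_le (hM i) hα
  set I' := Ideal.span (Set.range f') with hI'
  have hfI : ∀ i, f i ∈ I := fun i => Ideal.subset_span ⟨i, rfl⟩
  have hf'I : ∀ i, f' i ∈ I' := fun i => Ideal.subset_span ⟨i, rfl⟩
  have hXM : ∀ i, g * X i ^ (M - 1) ∈ I := fun i => hgN _ (by
    apply Ideal.pow_le_pow_right (show N ≤ M - 1 by omega)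
    exact Ideal.pow_mem_pow (Ideal.subset_span (Set.mem_range_self i)) _)
  have hXM' : ∀ i, g * X i ^ M = X i * (g * X i ^ (M - 1)) := fun i => by
    obtain ⟨k, rfl⟩ : ∃ k, M = k + 1 := ⟨M - 1, by omega⟩
    simp only [Nat.add_sub_cancel]; ring
  have hle : I ≤ I' ⊔ RingHom.ker (evq t) * I := by
    rw [hI, Ideal.span_le]
    rintro _ ⟨i, rfl⟩
    have hc : evq (σ := σ) t (C (Polynomial.C ((evq t g)⁻¹))) = (evq t g)⁻¹ := by
      rw [evq_C]; simp
    set c : MvPolynomial σ (Polynomial ℂ) := C (Polynomial.C ((evq t g)⁻¹))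
    have : f i = c * g * f' i + (-(c * X i) * (g * X i ^ (M - 1)) + (1 - c * g) * f i) := by
      have := hXM' i
      simp only [f']
      linear_combination (-c) * this
    rw [this]
    refine Submodule.add_mem_sup (Ideal.mul_mem_left _ _ (hf'I i)) (Ideal.add_mem _ ?_ ?_)
    · refine Ideal.mul_mem_mul ?_ (hXM i)
      rw [RingHom.mem_ker, map_neg, map_mul, evq_X, mul_zero, neg_zero]
    · refine Ideal.mul_mem_mul ?_ (hfI i)
      rw [RingHom.mem_ker, map_sub, map_mul, hc, map_one, inv_mul_cancel₀ hg, sub_self]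
  obtain ⟨g', hg', hg'I⟩ := nak _ I' I (Submodule.fg_span (Set.finite_range _)) hle
  have hg'1 : evq t g' = 1 := by
    rw [RingHom.mem_ker, map_sub, map_one, sub_eq_zero] at hg'; exact hg'
  have hgI' : ∀ x ∈ I', g * x ∈ I := by
    intro x hx
    have : I' ≤ Submodule.comap (LinearMap.mulLeft (MvPolynomial σ (Polynomial ℂ)) g) I := by
      rw [hI', Ideal.span, Submodule.span_le]
      rintro _ ⟨i, rfl⟩
      change g * f' i ∈ I
      simp only [f', mul_add]
      refine I.add_mem (I.mul_mem_left _ (hfI i)) ?_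
      rw [hXM']; exact I.mul_mem_left _ (hXM i)
    exact this hx
  have h1 : g * (C (Polynomial.X - Polynomial.C t) * e) ∈ I := by
    obtain ⟨a, ha, b, hb, hab⟩ := Submodule.mem_sup.mp he
    rw [← hab, mul_add]
    exact I.add_mem (I.mul_mem_left _ ha) (hgN b hb)
  have h2 := hg'I _ h1
  have h3 : g' * g * e ∈ I' := by
    refine torsion_free_quot (f := f') (M := M) (by omega) hlead _
      (Polynomial.X_sub_C_ne_zero t) _ ?_
    convert h2 using 1; ring
  have h4 := hgI' _ h3
  refine elim_unit I N t (g * (g' * g)) e ?_ ?_ he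
  · rw [map_mul, map_mul, hg'1, one_mul]; exact mul_ne_zero hg hg
  · rw [mul_assoc]; exact Ideal.mem_sup_left h4

lemma Triv.stab {f : σ → MvPolynomial σ (Polynomial ℂ)} {t : ℂ}
    {g : MvPolynomial σ (Polynomial ℂ)} {N : ℕ} (hg : evq t g ≠ 0)
    (hgN : ∀ x ∈ idealOfVars σ (Polynomial ℂ) ^ N, g * x ∈ Ideal.span (Set.range f)) :
    (Ideal.span (Set.range f)).map (sp t) ⊔ idealOfVars σ ℂ ^ N =
      (Ideal.span (Set.range f)).map (sp t) ⊔ idealOfVars σ ℂ ^ (N+1) := by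
  refine le_antisymm (sup_le le_sup_left ?_)
    (sup_le_sup_left (Ideal.pow_le_pow_right (Nat.le_succ N)) _)
  intro x hx
  have hx0 := hx
  rw [← map_vars t, Ideal.mem_map_iff_of_surjective _ (sp_surj t)] at hx
  obtain ⟨y, hy, rfl⟩ := hx
  have h1 := Ideal.mem_map_of_mem (sp t) (hgN y hy)
  rw [map_mul] at h1
  have h2 := sub_C_mem (sp t g)
  rw [constCoeff_sp] at h2
  have h3 : (sp t g - C (evq t g)) * sp t y ∈ idealOfVars σ ℂ ^ (N+1) := by
    rw [pow_succ']; exact Ideal.mul_mem_mul h2 hx0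
  have : sp t y = C ((evq t g)⁻¹) * (sp t g * sp t y - (sp t g - C (evq t g)) * sp t y) := by
    have : (C ((evq t g)⁻¹) : MvPolynomial σ ℂ) * C (evq t g) = 1 := by
      rw [← C_mul, inv_mul_cancel₀ hg, C_1]
    linear_combination (-sp t y) * this
  rw [this]
  exact Ideal.mul_mem_left _ _ (Ideal.sub_mem _ (Ideal.mem_sup_left h1) (Ideal.mem_sup_right h3))

theorem T1 {f : σ → MvPolynomial σ (Polynomial ℂ)} {t0 : ℂ} (h : Triv f t0) :
    ∃ v, HasMu ((Ideal.span (Set.range f)).map (sp t0)) v ∧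
      ∀ t w, HasMu ((Ideal.span (Set.range f)).map (sp t)) w → v ≤ w := by
  obtain ⟨g, N, hg, hgN⟩ := h
  refine ⟨_, HasMu.of_pow_le (Triv.stab hg hgN), fun t w hw => ?_⟩
  obtain ⟨r, h1, -⟩ := DD_family (Ideal.span (Set.range f)) N
  rw [(h1 t0).2.mpr (Triv.TF hg hgN)]
  exact (h1 t).1.trans (hw.DD_le N)

theorem T2 {f : σ → MvPolynomial σ (Polynomial ℂ)} {t0 : ℂ} {v : ℕ}
    (hv : HasMu ((Ideal.span (Set.range f)).map (sp t0)) v)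
    (hmin : ∀ t w, HasMu ((Ideal.span (Set.range f)).map (sp t)) w → v ≤ w) : Triv f t0 := by
  set I := Ideal.span (Set.range f) with hI
  obtain ⟨N0, hN0⟩ := hv.eventually
  set N := max N0 (v + 1) with hN
  obtain ⟨hst, hDv⟩ := hN0 N (le_max_left _ _)
  have hvN : v < N := lt_of_lt_of_le (Nat.lt_succ_self v) (le_max_right _ _)
  obtain ⟨r, h1, a, ha⟩ := DD_family I N
  have hra := (h1 a).2.mpr ha
  have hr0 := (h1 t0).1
  have hva : v ≤ DD N (I.map (sp a)) := hmin a _ (HasMu.of_lt (by omega))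
  have hTF : TF I N t0 := (h1 t0).2.mp (by omega)
  have hle : idealOfVars σ (Polynomial ℂ) ^ N ≤
      I ⊔ RingHom.ker (evq t0) * idealOfVars σ (Polynomial ℂ) ^ N := by
    intro x hx
    have hsx : sp t0 x ∈ (I ⊔ idealOfVars σ (Polynomial ℂ) ^ (N+1)).map (sp t0) := by
      rw [Ideal.map_sup, map_vars, ← hst]
      refine Ideal.mem_sup_right ?_
      rw [← map_vars t0]
      exact Ideal.mem_map_of_mem _ hx
    rw [Ideal.mem_map_iff_of_surjective _ (sp_surj t0)] at hsx
    obtain ⟨y, hy, hyx⟩ := hsx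
    obtain ⟨e, he⟩ := sp_eq_zero (t := t0) (p := x - y) (by rw [map_sub, hyx, sub_self])
    have hey : e ∈ I ⊔ idealOfVars σ (Polynomial ℂ) ^ N := hTF e (by
      rw [← he]
      exact Ideal.sub_mem _ (Ideal.mem_sup_right hx)
        ((sup_le_sup le_rfl (Ideal.pow_le_pow_right (Nat.le_succ N)) :
          I ⊔ idealOfVars σ (Polynomial ℂ) ^ (N+1) ≤ _) hy))
    have hx' : x = y + C (Polynomial.X - Polynomial.C t0) * e := by rw [← he]; ring
    rw [hx']
    refine Ideal.add_mem _ ?_ ?_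
    · refine (sup_le_sup le_rfl ?_ : I ⊔ idealOfVars σ (Polynomial ℂ) ^ (N+1) ≤ _) hy
      rw [pow_succ']
      exact Ideal.mul_mono_left (vars_le_ker t0)
    · obtain ⟨u, hu, w, hw, rfl⟩ := Submodule.mem_sup.mp hey
      rw [mul_add]
      exact Submodule.add_mem_sup (I.mul_mem_left _ hu)
        (Ideal.mul_mem_mul (xt_mem_ker t0) hw)
  obtain ⟨g, hg, hg'⟩ := nak _ I _ ((idealOfVars_fg σ (Polynomial ℂ)).pow) hle
  refine ⟨g, N, ?_, hg'⟩
  rw [RingHom.mem_ker, map_sub, map_one, sub_eq_zero] at hg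
  rw [hg]; exact one_ne_zero

/-- combining the coordinates -/
lemma combine {A : Type*} [CommRing A] (J I : Ideal A) (φ : A →+* ℂ) {ι : Type*} [Finite ι]
    (x : ι → A) (hJ : J = Ideal.span (Set.range x))
    (h : ∀ i, ∃ g N, φ g ≠ 0 ∧ g * x i ^ N ∈ I) :
    ∃ g N, φ g ≠ 0 ∧ ∀ y ∈ J ^ N, g * y ∈ I := by
  classical
  have := Fintype.ofFinite ι
  choose g N hg hgN using h
  let G := ∏ i, g i
  have hG : φ G ≠ 0 := by
    rw [map_prod]; exact Finset.prod_ne_zero_iff.mpr fun i _ => hg i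
  let L : Ideal A := Submodule.comap (LinearMap.mulLeft A G) I
  have hL : ∀ y, y ∈ L ↔ G * y ∈ I := fun y => Iff.rfl
  have hrad : J ≤ L.radical := by
    rw [hJ, Ideal.span_le]
    rintro _ ⟨i, rfl⟩
    refine ⟨N i, (hL _).mpr ?_⟩
    have : G = (∏ j ∈ Finset.univ.erase i, g j) * g i :=
      (Finset.prod_erase_mul _ _ (Finset.mem_univ i)).symm
    rw [this, mul_assoc]
    exact I.mul_mem_left _ (hgN i)
  obtain ⟨K, hK⟩ := Ideal.exists_pow_le_of_le_radical_of_fg hrad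
    (hJ ▸ Submodule.fg_span (Set.finite_range x))
  exact ⟨G, K, hG, fun y hy => hK hy⟩

end PF

end

section

namespace PF
/-! ### Formal arcs -/

lemma algHom_eq_of_ker_le {A : Type*} [CommRing A] [Algebra ℂ A] (φ ψ : A →ₐ[ℂ] ℂ)
    (h : ∀ a, φ a = 0 → ψ a = 0) : φ = ψ := by
  ext a
  have := h (a - algebraMap ℂ A (φ a)) (by simp)
  rw [map_sub, AlgHom.commutes, sub_eq_zero] at this
  exact this.symm

lemma ext_hom' {A B : Type*} [CommRing A] [CommRing B] [Algebra ℂ A] [Algebra ℂ B]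
    (ι : A →ₐ[ℂ] B) (hIntegral : ι.toRingHom.IsIntegral) (φ : A →ₐ[ℂ] ℂ)
    (hk : ∀ a, ι a = 0 → φ a = 0) :
    ∃ c : B →ₐ[ℂ] ℂ, c.comp ι = φ := by
  let := ι.toRingHom.toAlgebra
  have hmap : ∀ a, algebraMap A B a = ι a := fun a => rfl
  have : Algebra.IsIntegral A B := ⟨hIntegral⟩
  have hs : Function.Surjective φ := fun z => ⟨algebraMap ℂ A z, by simp⟩
  have hmax : (RingHom.ker φ).IsMaximal := RingHom.ker_isMaximal_of_surjective φ hs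
  obtain ⟨n, hn, hn'⟩ := Ideal.exists_ideal_over_maximal_of_isIntegral (S := B) (RingHom.ker φ)
    (fun a ha => hk a ha)
  let := Ideal.Quotient.field n
  have : Algebra.IsIntegral ℂ (B ⧸ n) := by
    refine ⟨fun x => ?_⟩
    obtain ⟨b, rfl⟩ := Ideal.Quotient.mk_surjective x
    obtain ⟨p, hp, hpb⟩ := hIntegral b
    refine ⟨p.map φ.toRingHom, hp.map _, ?_⟩
    rw [Polynomial.eval₂_map]
    have : (algebraMap ℂ (B ⧸ n)).comp φ.toRingHom = (Ideal.Quotient.mk n).comp ι.toRingHom := by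
      ext a
      have h1 : a - algebraMap ℂ A (φ a) ∈ RingHom.ker φ := by simp
      rw [← hn', Ideal.mem_comap, hmap, ← Ideal.Quotient.eq_zero_iff_mem, map_sub, map_sub,
        sub_eq_zero] at h1
      simp only [RingHom.comp_apply]
      change algebraMap ℂ (B ⧸ n) (φ a) = Ideal.Quotient.mk n (ι a)
      rw [h1, AlgHom.commutes]; rfl
    rw [this, ← Polynomial.hom_eval₂]
    rw [hpb, map_zero]
  have hb := IsAlgClosed.algebraMap_bijective_of_isIntegral (k := ℂ) (K := B ⧸ n)
  let e := AlgEquiv.ofBijective (Algebra.ofId ℂ (B ⧸ n)) hb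
  refine ⟨(e.symm : (B ⧸ n) →ₐ[ℂ] ℂ).comp (Ideal.Quotient.mkₐ ℂ n), ?_⟩
  symm
  apply algHom_eq_of_ker_le
  intro a ha
  have : a ∈ n.comap (algebraMap A B) := hn' ▸ ha
  have h2 : Ideal.Quotient.mkₐ ℂ n (ι a) = 0 := Ideal.Quotient.eq_zero_iff_mem.mpr this
  simp only [AlgHom.comp_apply, h2, map_zero]

lemma ext_hom {A B : Type*} [CommRing A] [CommRing B] [Algebra ℂ A] [Algebra ℂ B]
    (ι : A →ₐ[ℂ] B) (hi : Function.Injective ι) (hIntegral : ι.toRingHom.IsIntegral) (φ : A →ₐ[ℂ] ℂ) :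
    ∃ c : B →ₐ[ℂ] ℂ, c.comp ι = φ :=
  ext_hom' ι hIntegral φ fun a ha => by
    rw [(injective_iff_map_eq_zero ι).mp hi a ha, map_zero]

lemma arc_of_V {V : Type*} [CommRing V] [IsDomain V] [IsNoetherianRing V] [Algebra ℂ V]
    (c : V →ₐ[ℂ] ℂ) (ϖ : V) (h : RingHom.ker c = Ideal.span {ϖ}) :
    ∃ γ : V →ₐ[ℂ] PowerSeries ℂ, (∀ v, PowerSeries.constantCoeff (γ v) = c v) ∧
      Function.Injective γ := by
  by_cases h0 : ϖ = 0
  · refine ⟨(Algebra.ofId ℂ (PowerSeries ℂ)).comp c, fun v => ?_, ?_⟩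
    · simp [Algebra.ofId_apply, PowerSeries.algebraMap_apply]
    · rw [injective_iff_map_eq_zero]
      intro v hv
      have h1 : c v = 0 := by
        have := congrArg PowerSeries.constantCoeff hv
        simpa [Algebra.ofId_apply, PowerSeries.algebraMap_apply] using this
      have : v ∈ RingHom.ker c := h1
      rw [h, h0] at this
      simpa using this
  have hr : ∀ v, ∃ w, v = algebraMap ℂ V (c v) + ϖ * w := by
    intro v
    have : v - algebraMap ℂ V (c v) ∈ RingHom.ker c := by simp
    rw [h, Ideal.mem_span_singleton] at this
    obtain ⟨w, hw⟩ := this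
    exact ⟨w, by rw [← hw]; ring⟩
  choose r hr using hr
  have huniq : ∀ v w z, v = algebraMap ℂ V z + ϖ * w → z = c v → w = r v := by
    intro v w z h1 hz
    have h2 := hr v
    rw [hz] at h1
    have : ϖ * w = ϖ * r v := by
      have := h1.symm.trans h2
      exact add_left_cancel this
    exact mul_left_cancel₀ h0 this
  have hradd : ∀ v w, r (v + w) = r v + r w := by
    intro v w
    refine (huniq (v + w) _ (c v + c w) ?_ (by simp)).symm
    conv_lhs => rw [hr v, hr w]
    rw [map_add]; ring
  have hrmul : ∀ v w, r (v * w) = algebraMap ℂ V (c v) * r w + r v * w := by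
    intro v w
    refine (huniq (v * w) _ (c v * c w) ?_ (by simp)).symm
    rw [map_mul]
    linear_combination w * hr v + algebraMap ℂ V (c v) * hr w
  have hr0 : ∀ z, r (algebraMap ℂ V z) = 0 := by
    intro z
    exact (huniq _ 0 z (by simp) (by simp)).symm
  have hr00 : r 0 = 0 := by simpa using hr0 0
  have hrs : ∀ {ι : Type} (s : Finset ι) (f : ι → V), r (∑ i ∈ s, f i) = ∑ i ∈ s, r (f i) := by
    intro ι s f
    exact map_sum (⟨⟨r, hr00⟩, hradd⟩ : V →+ V) f s
  have hrsm : ∀ z w, r (algebraMap ℂ V z * w) = algebraMap ℂ V z * r w := by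
    intro z w; rw [hrmul, hr0]; simp
  have hiter : ∀ n v w, r^[n] (v * w) =
      ∑ i ∈ Finset.range n, algebraMap ℂ V (c (r^[i] v)) * r^[n - i] w + r^[n] v * w := by
    intro n v w
    induction n with
    | zero => simp
    | succ n ih =>
      rw [Function.iterate_succ_apply', ih, hradd, hrs, hrmul, Finset.sum_range_succ]
      rw [← add_assoc, Function.iterate_succ_apply']
      congr 2
      · apply Finset.sum_congr rfl
        intro i hi
        rw [hrsm, show n + 1 - i = (n - i) + 1 by have := Finset.mem_range.mp hi; omega,
          Function.iterate_succ_apply']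
      · rw [show n + 1 - n = 1 by omega]; rfl
  have hitadd : ∀ n v w, r^[n] (v + w) = r^[n] v + r^[n] w := by
    intro n
    induction n with
    | zero => intro v w; rfl
    | succ n ih => intro v w; rw [Function.iterate_succ_apply, hradd, ih]; rfl
  have hit0 : ∀ n, r^[n] 0 = 0 := by
    intro n
    induction n with
    | zero => rfl
    | succ n ih => rw [Function.iterate_succ_apply, hr00, ih]
  have hexp : ∀ n v, (∀ i < n, c (r^[i] v) = 0) → v = ϖ ^ n * r^[n] v := by
    intro n
    induction n with
    | zero => intro v _; simp
    | succ n ih =>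
      intro v hv
      have h1 := ih v (fun i hi => hv i (by omega))
      have h2 := hr (r^[n] v)
      rw [hv n (by omega), map_zero, zero_add] at h2
      rw [Function.iterate_succ_apply']
      calc v = ϖ ^ n * r^[n] v := h1
        _ = ϖ ^ n * (ϖ * r (r^[n] v)) := by rw [← h2]
        _ = _ := by ring
  have hconst : ∀ z n, c (r^[n] (algebraMap ℂ V z)) = PowerSeries.coeff n (PowerSeries.C z) := by
    intro z n
    cases n with
    | zero => simp
    | succ n => rw [Function.iterate_succ_apply, hr0, hit0]; simp [PowerSeries.coeff_C]
  let γ : V →ₐ[ℂ] PowerSeries ℂ :=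
    { toFun := fun v => PowerSeries.mk fun n => c (r^[n] v)
      map_one' := by
        ext n
        rw [PowerSeries.coeff_mk, ← map_one (algebraMap ℂ V), hconst]; simp
      map_zero' := by
        ext n; rw [PowerSeries.coeff_mk, hit0]; simp
      map_add' := by
        intro v w; ext n; simp [hitadd]
      map_mul' := by
        intro v w; ext n
        rw [PowerSeries.coeff_mk, PowerSeries.coeff_mul, hiter,
          Finset.Nat.sum_antidiagonal_eq_sum_range_succ_mk, Finset.sum_range_succ]
        simp
      commutes' := by
        intro z; ext n
        rw [PowerSeries.coeff_mk, hconst]; rfl }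
  have hγ : ∀ v n, PowerSeries.coeff n (γ v) = c (r^[n] v) := fun v n =>
    PowerSeries.coeff_mk n (fun n => c (r^[n] v))
  refine ⟨γ, fun v => ?_, ?_⟩
  · rw [← PowerSeries.coeff_zero_eq_constantCoeff_apply, hγ]; rfl
  · rw [injective_iff_map_eq_zero]
    intro v hv
    have h1 : ∀ n, v ∈ Ideal.span {ϖ} ^ n := by
      intro n
      rw [Ideal.span_singleton_pow, Ideal.mem_span_singleton]
      exact ⟨_, hexp n v fun i _ => by rw [← hγ, hv, map_zero]⟩
    have hne : Ideal.span {ϖ} ≠ ⊤ := by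
      rw [← h]; exact RingHom.ker_ne_top c.toRingHom
    have := Ideal.iInf_pow_eq_bot_of_isDomain _ hne
    have h2 : v ∈ (⨅ i : ℕ, Ideal.span {ϖ} ^ i : Ideal V) := by
      rw [Ideal.mem_iInf]; exact h1
    rw [this] at h2
    exact h2

lemma arc_of_dedekind {B : Type*} [CommRing B] [IsDedekindDomain B] [Algebra ℂ B]
    (c : B →ₐ[ℂ] ℂ) :
    ∃ γ : B →ₐ[ℂ] PowerSeries ℂ, (∀ v, PowerSeries.constantCoeff (γ v) = c v) ∧
      Function.Injective γ := by
  have hs : Function.Surjective c := fun z => ⟨algebraMap ℂ B z, by simp⟩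
  have hmax : (RingHom.ker c).IsMaximal := RingHom.ker_isMaximal_of_surjective c hs
  set n := RingHom.ker c with hn
  by_cases hb : n = ⊥
  · exact arc_of_V c 0 (by rw [← hn, hb]; simp)
  let V := Localization.AtPrime n
  have : IsNoetherianRing V := IsLocalization.isNoetherianRing n.primeCompl V inferInstance
  have := IsLocalization.AtPrime.isDiscreteValuationRing_of_dedekind_domain B hb V
  have hu : ∀ y : n.primeCompl, IsUnit (c.toRingHom y) := fun y => isUnit_iff_ne_zero.mpr y.2
  let cV : V →ₐ[ℂ] ℂ := IsLocalization.liftAlgHom (M := n.primeCompl) (f := c) hu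
  obtain ⟨ϖ, hϖ⟩ := IsPrincipalIdealRing.principal (RingHom.ker cV)
  obtain ⟨γ, h1, h2⟩ := arc_of_V cV ϖ hϖ
  refine ⟨γ.comp (IsScalarTower.toAlgHom ℂ B V), fun v => ?_, ?_⟩
  · simp [h1, cV]
  · exact h2.comp (IsLocalization.injective V n.primeCompl_le_nonZeroDivisors)

end PF

end

section

namespace PF

lemma arc_curve {A : Type} [CommRing A] [IsDomain A] [Algebra ℂ A]
    (ρ : Polynomial ℂ →ₐ[ℂ] A) (hi : Function.Injective ρ) (hf : ρ.Finite) (φ : A →ₐ[ℂ] ℂ) :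
    ∃ γ : A →ₐ[ℂ] PowerSeries ℂ, (∀ v, PowerSeries.constantCoeff (γ v) = φ v) ∧
      Function.Injective γ := by
  let := ρ.toRingHom.toAlgebra
  have hmap : ∀ a, algebraMap (Polynomial ℂ) A a = ρ a := fun a => rfl
  have : Module.Finite (Polynomial ℂ) A := hf
  have : FaithfulSMul (Polynomial ℂ) A := (faithfulSMul_iff_algebraMap_injective _ A).mpr hi
  let K := FractionRing (Polynomial ℂ)
  let L := FractionRing A
  let : Algebra K L := FractionRing.liftAlgebra (Polynomial ℂ) L
  have : IsScalarTower (Polynomial ℂ) K L := FractionRing.isScalarTower_liftAlgebra _ _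
  have : FiniteDimensional K L := .of_isLocalization (Polynomial ℂ) A (nonZeroDivisors (Polynomial ℂ))
  let B := integralClosure (Polynomial ℂ) L
  have : IsDedekindDomain B := integralClosure.isDedekindDomain (Polynomial ℂ) K L
  have hst : IsScalarTower ℂ (Polynomial ℂ) A := IsScalarTower.of_algebraMap_eq (fun x => by
    rw [hmap, ← ρ.commutes])
  have : IsScalarTower ℂ (Polynomial ℂ) L := by
    refine IsScalarTower.of_algebraMap_eq (fun x => ?_)
    rw [IsScalarTower.algebraMap_apply ℂ A L, IsScalarTower.algebraMap_apply ℂ (Polynomial ℂ) A,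
      ← IsScalarTower.algebraMap_apply (Polynomial ℂ) A L]
  let ι : A →ₐ[ℂ] B :=
    { toFun := fun a => ⟨algebraMap A L a, (Algebra.IsIntegral.isIntegral (R := Polynomial ℂ) a).algebraMap⟩
      map_one' := Subtype.ext (map_one _)
      map_mul' := fun a b => Subtype.ext (map_mul _ _ _)
      map_zero' := Subtype.ext (map_zero _)
      map_add' := fun a b => Subtype.ext (map_add _ _ _)
      commutes' := fun z => Subtype.ext (by
        change algebraMap A L (algebraMap ℂ A z) = algebraMap ℂ L z
        rw [← IsScalarTower.algebraMap_apply]) }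
  have hιi : Function.Injective ι := fun a b h => by
    have := congrArg Subtype.val h
    exact IsFractionRing.injective A L this
  have hIntegral : ι.toRingHom.IsIntegral := by
    intro b
    have hb : IsIntegral (Polynomial ℂ) b := Algebra.IsIntegral.isIntegral b
    obtain ⟨p, hp, hpb⟩ := hb
    refine ⟨p.map (algebraMap _ A), hp.map _, ?_⟩
    rw [Polynomial.eval₂_map]
    exact hpb
  obtain ⟨c, hc⟩ := ext_hom ι hιi hIntegral φ
  obtain ⟨γ, h1, h2⟩ := arc_of_dedekind c
  refine ⟨γ.comp ι, fun v => ?_, h2.comp hιi⟩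
  rw [← hc]; exact h1 _

/-- prime extraction -/
lemma exists_prime_sep {R : Type*} [CommRing R] [Algebra ℂ R] (φ : R →ₐ[ℂ] ℂ) (I : Ideal R) (w : R)
    (h : ¬ ∃ g N, φ g ≠ 0 ∧ g * w ^ N ∈ I) :
    ∃ Q : Ideal R, Q.IsPrime ∧ I ≤ Q ∧ Q ≤ RingHom.ker φ ∧ w ∉ Q := by
  let S : Submonoid R :=
    { carrier := {x | ∃ g N, φ g ≠ 0 ∧ x = g * w ^ N}
      one_mem' := ⟨1, 0, by simp, by simp⟩
      mul_mem' := by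
        rintro a b ⟨g, N, hg, rfl⟩ ⟨g', N', hg', rfl⟩
        exact ⟨g * g', N + N', by simp [hg, hg'], by ring⟩ }
  have hd : Disjoint (I : Set R) S := by
    rw [Set.disjoint_left]
    rintro x hx ⟨g, N, hg, rfl⟩
    exact h ⟨g, N, hg, hx⟩
  obtain ⟨Q, hQ, hIQ, hQd⟩ := Ideal.exists_le_prime_disjoint I S hd
  rw [Set.disjoint_left] at hQd
  refine ⟨Q, hQ, hIQ, fun x hx => ?_, fun hw => hQd hw ⟨1, 1, by simp, by simp⟩⟩
  by_contra hx'
  exact hQd hx ⟨x, 0, hx', by simp⟩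

end PF

end

section

namespace PF

lemma noether_data {A : Type} [CommRing A] [IsDomain A] [Algebra ℂ A] [Algebra.FiniteType ℂ A]
    (w : A) (hw : w ≠ 0) :
    ∃ (m : ℕ) (ι : MvPolynomial (Fin m) ℂ →ₐ[ℂ] A) (D : MvPolynomial (Fin m) ℂ),
      Function.Injective ι ∧ ι.Finite ∧ D ≠ 0 ∧ w ∣ ι D := by
  obtain ⟨m, ι, hi, hf⟩ := exists_finite_inj_algHom_of_fg ℂ A
  refine ⟨m, ι, ?_⟩
  let := ι.toRingHom.toAlgebra
  have : Module.Finite (MvPolynomial (Fin m) ℂ) A := hf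
  have h := Ideal.comap_ne_bot_of_integral_mem (R := MvPolynomial (Fin m) ℂ)
    (I := Ideal.span {w}) hw (Ideal.mem_span_singleton_self w) (Algebra.IsIntegral.isIntegral w)
  obtain ⟨D, hD, hD0⟩ := Submodule.exists_mem_ne_zero_of_ne_bot h
  exact ⟨D, hi, hf, hD0, Ideal.mem_span_singleton.mp hD⟩

lemma arc_domain {A : Type} [CommRing A] [IsDomain A] [Algebra ℂ A] [Algebra.FiniteType ℂ A]
    (φ : A →ₐ[ℂ] ℂ) (w : A) (hw : w ≠ 0) :
    ∃ γ : A →ₐ[ℂ] PowerSeries ℂ, (∀ v, PowerSeries.constantCoeff (γ v) = φ v) ∧ γ w ≠ 0 := by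
  by_cases hφw : φ w = 0
  swap
  · refine ⟨(Algebra.ofId ℂ (PowerSeries ℂ)).comp φ, fun v => ?_, fun h => hφw ?_⟩
    · simp [Algebra.ofId_apply]
    · have := congrArg PowerSeries.constantCoeff h
      simpa [Algebra.ofId_apply, PowerSeries.algebraMap_apply] using this
  obtain ⟨m, ι, D, hi, hf, hD, hwD⟩ := noether_data w hw
  let b : Fin m → ℂ := fun i => φ (ι (X i))
  have hb : ∀ s, φ (ι s) = eval b s := by
    intro s
    have : φ.comp ι = aeval b := by ext i; simp [b]
    have := DFunLike.congr_fun this s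
    simpa [aeval_eq_eval] using this
  obtain ⟨a, ha⟩ : ∃ a, eval a D ≠ 0 := by
    by_contra h
    push Not at h
    exact hD (MvPolynomial.funext (by simpa using h))
  have hDb : eval b D = 0 := by
    rw [← hb]; obtain ⟨q, hq⟩ := hwD; rw [hq, map_mul, hφw, zero_mul]
  let l : (MvPolynomial (Fin m) ℂ) →ₐ[ℂ] Polynomial ℂ :=
    aeval fun i => Polynomial.C (b i) + Polynomial.C (a i - b i) * Polynomial.X
  have hl0 : ∀ s, Polynomial.eval 0 (l s) = eval b s := by
    intro s
    have : (Polynomial.aeval (0:ℂ)).comp l = aeval b := by ext i; simp [l]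
    have := DFunLike.congr_fun this s
    simpa [aeval_eq_eval, Polynomial.aeval_def] using this
  have hl1 : ∀ s, Polynomial.eval 1 (l s) = eval a s := by
    intro s
    have : (Polynomial.aeval (1:ℂ)).comp l = aeval a := by ext i; simp [l]
    have := DFunLike.congr_fun this s
    simpa [aeval_eq_eval, Polynomial.aeval_def] using this
  obtain ⟨i0, hi0⟩ : ∃ i, a i ≠ b i := by
    by_contra h
    push Not at h
    exact ha (by rw [_root_.funext h]; exact hDb)
  have hsub : a i0 - b i0 ≠ 0 := sub_ne_zero.mpr hi0
  let μ : Polynomial ℂ →ₐ[ℂ] (MvPolynomial (Fin m) ℂ) := Polynomial.aeval (C (a i0 - b i0)⁻¹ * (X i0 - C (b i0)))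
  have hlμ : ∀ q, l (μ q) = q := by
    intro q
    have : l.comp μ = AlgHom.id ℂ _ := by
      apply Polynomial.algHom_ext
      simp only [AlgHom.comp_apply, μ, Polynomial.aeval_X, map_mul, map_sub, AlgHom.id_apply, l, aeval_X]
      simp only [algHom_C, ← Polynomial.C_eq_algebraMap]
      rw [add_sub_cancel_left, ← mul_assoc, ← Polynomial.C_sub, ← Polynomial.C_mul, inv_mul_cancel₀ hsub]; simp
    exact DFunLike.congr_fun this q
  let := ι.toRingHom.toAlgebra
  have hmap : ∀ s, algebraMap (MvPolynomial (Fin m) ℂ) A s = ι s := fun _ => rfl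
  have : Module.Finite (MvPolynomial (Fin m) ℂ) A := hf
  have : FaithfulSMul (MvPolynomial (Fin m) ℂ) A := (faithfulSMul_iff_algebraMap_injective (MvPolynomial (Fin m) ℂ) A).mpr hi
  let P : Ideal (MvPolynomial (Fin m) ℂ) := RingHom.ker l
  have hPp : P.IsPrime := RingHom.ker_isPrime l
  have hφp : (RingHom.ker φ).IsPrime := RingHom.ker_isPrime φ
  let q : Ideal (MvPolynomial (Fin m) ℂ) := (RingHom.ker φ).under (MvPolynomial (Fin m) ℂ)
  have : (RingHom.ker φ).LiesOver q := ⟨rfl⟩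
  have hq : q.IsPrime := inferInstance
  have hPq : P ≤ q := by
    intro s hs
    change φ (ι s) = 0
    rw [hb, ← hl0, show l s = 0 from hs]; simp
  obtain ⟨Q, hQφ, hQ, hQP⟩ := Ideal.exists_ideal_le_liesOver_of_le (p := P) (q := q) (RingHom.ker φ) hPq
  have hQP' : ∀ s, ι s ∈ Q ↔ l s = 0 := by
    intro s
    have := hQP.over
    have h2 : s ∈ P ↔ s ∈ Q.under (MvPolynomial (Fin m) ℂ) := by rw [← this]
    exact h2.symm
  have hwQ : w ∉ Q := by
    intro h
    have h1 : ι D ∈ Q := Ideal.mem_of_dvd _ hwD h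
    rw [hQP'] at h1
    exact ha (by rw [← hl1, h1]; simp)
  let ρ : Polynomial ℂ →ₐ[ℂ] A ⧸ Q := ((Ideal.Quotient.mkₐ ℂ Q).comp ι).comp μ
  have hρl : ∀ s, Ideal.Quotient.mk Q (ι s) = ρ (l s) := by
    intro s
    change _ = Ideal.Quotient.mk Q (ι (μ (l s)))
    rw [Ideal.Quotient.eq, ← map_sub, hQP', map_sub, hlμ, sub_self]
  have hρi : Function.Injective ρ := by
    rw [injective_iff_map_eq_zero]
    intro r hr
    have : ι (μ r) ∈ Q := Ideal.Quotient.eq_zero_iff_mem.mp hr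
    rwa [hQP', hlμ] at this
  have hρf : ρ.Finite := by
    have h1 : ((Ideal.Quotient.mkₐ ℂ Q).comp ι).Finite :=
      AlgHom.Finite.comp (AlgHom.Finite.of_surjective _ Ideal.Quotient.mk_surjective) hf
    have h2 : (Ideal.Quotient.mkₐ ℂ Q).comp ι = ρ.comp l := AlgHom.ext hρl
    rw [h2] at h1
    exact AlgHom.Finite.of_comp_finite h1
  have hker : ∀ a ∈ Q, φ a = 0 := fun a ha => hQφ ha
  obtain ⟨γ, h1, h2⟩ := arc_curve ρ hρi hρf (Ideal.Quotient.liftₐ Q φ hker)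
  refine ⟨γ.comp (Ideal.Quotient.mkₐ ℂ Q), fun v => ?_, fun h => hwQ ?_⟩
  · exact h1 _
  · have := (injective_iff_map_eq_zero γ).mp h2 _ h
    exact Ideal.Quotient.eq_zero_iff_mem.mp this

lemma arc_lemma {R : Type} [CommRing R] [Algebra ℂ R] [Algebra.FiniteType ℂ R]
    (φ : R →ₐ[ℂ] ℂ) (I : Ideal R) (w : R)
    (h : ∀ γ : R →ₐ[ℂ] PowerSeries ℂ, (∀ v, PowerSeries.constantCoeff (γ v) = φ v) →
      (∀ v ∈ I, γ v = 0) → γ w = 0) :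
    ∃ g N, φ g ≠ 0 ∧ g * w ^ N ∈ I := by
  by_contra hc
  obtain ⟨Q, hQ, hIQ, hQφ, hw⟩ := exists_prime_sep φ I w hc
  obtain ⟨γ, h1, h2⟩ := arc_domain (Ideal.Quotient.liftₐ Q φ fun a ha => hQφ ha)
    (Ideal.Quotient.mk Q w) (fun h => hw (Ideal.Quotient.eq_zero_iff_mem.mp h))
  refine h2 (h (γ.comp (Ideal.Quotient.mkₐ ℂ Q)) (fun v => h1 _) (fun v hv => ?_))
  change γ (Ideal.Quotient.mk Q v) = 0
  rw [Ideal.Quotient.eq_zero_iff_mem.mpr (hIQ hv), map_zero]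

end PF

end

section

namespace PF

lemma exists_sep {A : Type} [CommRing A] [Algebra ℂ A] (φ : A →ₐ[ℂ] ℂ) (m : ℕ)
    (ι : MvPolynomial (Fin m) ℂ →ₐ[ℂ] A) (hf : ι.Finite) :
    ∃ g, φ g = 0 ∧ ∀ ψ : A →ₐ[ℂ] ℂ, ψ.comp ι = φ.comp ι → ψ g = 0 → ψ = φ := by
  let J : Ideal A := (RingHom.ker (φ.comp ι)).map ι
  have hfin : Module.Finite ℂ (A ⧸ J) := by
    let f : MvPolynomial (Fin m) ℂ →ₐ[ℂ] A ⧸ J := (Ideal.Quotient.mkₐ ℂ J).comp ι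
    have h1 : f.Finite :=
      AlgHom.Finite.comp (AlgHom.Finite.of_surjective _ Ideal.Quotient.mk_surjective) hf
    have h2 : f = (Algebra.ofId ℂ (A ⧸ J)).comp (φ.comp ι) := by
      ext i
      have h3 : X i - C (φ (ι (X i))) ∈ RingHom.ker (φ.comp ι) := by
        simp [algHom_C]
      have h4 : ι (X i - C (φ (ι (X i)))) ∈ J := Ideal.mem_map_of_mem ι h3
      have h5 := Ideal.Quotient.eq_zero_iff_mem.mpr h4
      rw [map_sub, map_sub, sub_eq_zero, algHom_C] at h5
      exact h5
    rw [h2] at h1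
    have h3 := AlgHom.Finite.of_comp_finite h1
    exact RingHom.finite_algebraMap.mp h3
  have : Finite ((A ⧸ J) →ₐ[ℂ] ℂ) := (linearIndependent_toLinearMap ℂ (A ⧸ J) ℂ).finite
  have hfinset : {ψ : A →ₐ[ℂ] ℂ | ψ.comp ι = φ.comp ι}.Finite := by
    apply Set.Finite.subset (Set.finite_range fun χ : (A ⧸ J) →ₐ[ℂ] ℂ => χ.comp (Ideal.Quotient.mkₐ ℂ J))
    intro ψ hψ
    have hJ : ∀ a ∈ J, ψ a = 0 := by
      intro a ha
      have : J ≤ RingHom.ker ψ := by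
        rw [Ideal.map_le_iff_le_comap]
        intro s hs
        change ψ (ι s) = 0
        exact (DFunLike.congr_fun hψ s).trans hs
      exact this ha
    exact ⟨Ideal.Quotient.liftₐ J ψ hJ, AlgHom.ext fun a => rfl⟩
  classical
  let s := (hfinset.toFinset).erase φ
  have hns : ¬ ∃ i ∈ s, RingHom.ker φ ≤ RingHom.ker i := by
    rintro ⟨ψ, hψ, hle⟩
    have := algHom_eq_of_ker_le φ ψ (fun a ha => hle ha)
    exact (Finset.ne_of_mem_erase hψ) this.symm
  rw [← Ideal.subset_union_prime φ φ (fun i _ _ _ => RingHom.ker_isPrime i), Set.not_subset] at hns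
  obtain ⟨g, hg, hg'⟩ := hns
  refine ⟨g, hg, fun ψ hψ hψg => ?_⟩
  by_contra hne
  apply hg'
  simp only [Set.mem_iUnion]
  exact ⟨ψ, by simp [s, hne, hψ], hψg⟩

lemma small_root (p : Polynomial ℂ) (hp : p.Monic) (hd : 0 < p.natDegree) :
    ∃ z, p.eval z = 0 ∧ ‖z‖ ^ p.natDegree ≤ ‖p.coeff 0‖ := by
  have hs := IsAlgClosed.splits p
  have h0 := hs.coeff_zero_eq_prod_roots_of_monic hp
  have hcard : p.roots.card = p.natDegree := hs.natDegree_eq_card_roots.symm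
  have hne : p.roots.toFinset.Nonempty := by
    rw [Multiset.toFinset_nonempty]
    intro h
    rw [h] at hcard
    simp at hcard; omega
  obtain ⟨z, hz, hmin⟩ := Finset.exists_min_image p.roots.toFinset (fun z => ‖z‖) hne
  have hz' : z ∈ p.roots := Multiset.mem_toFinset.mp hz
  refine ⟨z, (Polynomial.mem_roots'.mp hz').2, ?_⟩
  have key : ∀ s : Multiset ℂ, (∀ x ∈ s, ‖z‖ ≤ ‖x‖) → ‖z‖ ^ s.card ≤ ‖s.prod‖ := by
    intro s
    induction s using Multiset.induction with
    | empty => simp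
    | cons a s ih =>
      intro h
      rw [Multiset.card_cons, Multiset.prod_cons, norm_mul, pow_succ']
      exact mul_le_mul (h a (by simp)) (ih fun x hx => h x (by simp [hx])) (by positivity) (by positivity)
  rw [h0, norm_mul, norm_pow, norm_neg, norm_one, one_pow, one_mul, ← hcard]
  exact key _ fun x hx => hmin x (Multiset.mem_toFinset.mpr hx)

lemma root_bound (p : Polynomial ℂ) (hp : p.Monic) (z : ℂ) (hz : p.eval z = 0) (n : ℕ)
    (hn : p.natDegree = n) :
    ‖z‖ ≤ ∑ i ∈ Finset.range n, ‖p.coeff i‖ + 1 := by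
  have h := Polynomial.IsRoot.norm_lt_cauchyBound hp.ne_zero hz
  have h2 : Polynomial.cauchyBound p ≤ ∑ i ∈ Finset.range n, ‖p.coeff i‖₊ + 1 := by
    unfold Polynomial.cauchyBound
    rw [hp.leadingCoeff, hn]
    simp only [nnnorm_one, div_one]
    gcongr
    apply Finset.sup_le
    intro i hi
    exact Finset.single_le_sum (f := fun i => ‖p.coeff i‖₊) (fun _ _ => zero_le) hi
  have h3 : (‖z‖₊ : ℝ) ≤ _ := NNReal.coe_le_coe.mpr (h.le.trans h2)
  simpa using h3

end PF

end

section

namespace PF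

lemma approx_pts {m : ℕ} (b : Fin m → ℂ) (D : MvPolynomial (Fin m) ℂ) (hD : D ≠ 0) :
    ∃ bk : ℕ → Fin m → ℂ, Tendsto bk atTop (𝓝 b) ∧ ∀ k, eval (bk k) D ≠ 0 := by
  obtain ⟨a, ha⟩ : ∃ a, eval a D ≠ 0 := by
    by_contra h
    push Not at h
    exact hD (MvPolynomial.funext (by simpa using h))
  let l' : MvPolynomial (Fin m) ℂ →ₐ[ℂ] Polynomial ℂ :=
    aeval (fun i => Polynomial.C (b i) + Polynomial.C (a i - b i) * Polynomial.X)
  let l := l' D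
  have hl : ∀ z : ℂ, l.eval z = eval (fun i => b i + (a i - b i) * z) D := by
    intro z
    have : (Polynomial.aeval z).comp l'
      = (aeval (fun i => b i + (a i - b i) * z) : MvPolynomial (Fin m) ℂ →ₐ[ℂ] ℂ) := by ext i; simp [l']
    have h2 := DFunLike.congr_fun this D
    rw [aeval_eq_eval] at h2
    exact h2
  have hl0 : l ≠ 0 := by
    intro h
    apply ha
    have := hl 1
    rw [h] at this
    simpa using this.symm
  have hfin : (l.roots.toFinset : Set ℂ).Finite := Finset.finite_toSet _
  let e : ℕ → ℂ := fun k => 1 / ((k : ℂ) + 1)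
  have he : Tendsto e atTop (𝓝 0) := tendsto_one_div_add_atTop_nhds_zero_nat
  have hinj : Function.Injective e := by
    intro x y h
    have : ((x:ℂ) + 1)⁻¹ = ((y:ℂ)+1)⁻¹ := by simpa [e] using h
    have := inv_injective this
    exact_mod_cast add_right_cancel this
  have hev : ∀ᶠ k in atTop, l.eval (e k) ≠ 0 := by
    have : (e ⁻¹' (l.roots.toFinset : Set ℂ)).Finite := hfin.preimage hinj.injOn
    rw [← Nat.cofinite_eq_atTop]
    filter_upwards [this.compl_mem_cofinite] with k hk h
    apply hk
    simp [hl0, h]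
  obtain ⟨K, hK⟩ := eventually_atTop.mp hev
  refine ⟨fun k i => b i + (a i - b i) * e (k + K), ?_, fun k => ?_⟩
  · rw [tendsto_pi_nhds]
    intro i
    have h1 : Tendsto (fun k => e (k + K)) atTop (𝓝 0) := (tendsto_add_atTop_iff_nat K).mpr he
    have := (h1.const_mul (a i - b i)).const_add (b i)
    simpa using this
  · rw [← hl]; exact hK _ (by omega)

set_option maxHeartbeats 1000000 in
lemma seq_domain {A : Type} [CommRing A] [IsDomain A] [Algebra ℂ A] [Algebra.FiniteType ℂ A]
    (φ : A →ₐ[ℂ] ℂ) (w : A) (hw : w ≠ 0) :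
    ∃ ψ : ℕ → (A →ₐ[ℂ] ℂ), (∀ k, ψ k w ≠ 0) ∧ ∀ a, Tendsto (fun k => ψ k a) atTop (𝓝 (φ a)) := by
  obtain ⟨m, ι, D, hi, hf, hD, hwD⟩ := noether_data w hw
  obtain ⟨g, hg, hguniq⟩ := exists_sep φ m ι hf
  let b : Fin m → ℂ := fun i => φ (ι (X i))
  have hb : φ.comp ι = aeval b := by ext i; simp [b]
  obtain ⟨bk, hbk, hDk⟩ := approx_pts b D hD
  have hcont : ∀ s : MvPolynomial (Fin m) ℂ, Tendsto (fun k => eval (bk k) s) atTop (𝓝 (eval b s)) :=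
    fun s => ((MvPolynomial.continuous_eval s).tendsto b).comp hbk
  let := ι.toRingHom.toAlgebra
  have hmap : ∀ s, algebraMap (MvPolynomial (Fin m) ℂ) A s = ι s := fun _ => rfl
  have : Module.Finite (MvPolynomial (Fin m) ℂ) A := hf
  have : FaithfulSMul (MvPolynomial (Fin m) ℂ) A := (faithfulSMul_iff_algebraMap_injective _ A).mpr hi
  have hintg : ∀ a : A, IsIntegral (MvPolynomial (Fin m) ℂ) a := Algebra.IsIntegral.isIntegral
  let M := minpoly (MvPolynomial (Fin m) ℂ) g
  have hM : M.Monic := minpoly.monic (hintg g)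
  -- evaluating polynomial relations
  have hrel : ∀ (χ : A →ₐ[ℂ] ℂ) (c : Fin m → ℂ), χ.comp ι = aeval c →
      ∀ (q : Polynomial (MvPolynomial (Fin m) ℂ)) (a : A), Polynomial.aeval a q = 0 →
        (q.map (eval c)).eval (χ a) = 0 := by
    intro χ c hχ q a hq
    have h1 : χ.toRingHom.comp ι.toRingHom = eval c := by
      ext s
      · simp
      · have := DFunLike.congr_fun hχ (X s)
        simpa using this
    rw [Polynomial.eval_map, ← h1]
    have h2 := congrArg χ hq
    rw [map_zero] at h2
    rw [← h2, Polynomial.aeval_def]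
    exact (Polynomial.hom_eval₂ q ι.toRingHom χ.toRingHom a).symm
  have hM0 : eval b (M.coeff 0) = 0 := by
    have := hrel φ b hb M g (minpoly.aeval _ g)
    rw [hg] at this
    rw [← Polynomial.coeff_zero_eq_eval_zero, Polynomial.coeff_map] at this
    exact this
  have hdeg : ∀ c : Fin m → ℂ, (M.map (eval c)).natDegree = M.natDegree := fun c => hM.natDegree_map _
  have hMd : 0 < M.natDegree := minpoly.natDegree_pos (hintg g)
  have hex : ∀ k, ∃ ψ : A →ₐ[ℂ] ℂ, ψ.comp ι = aeval (bk k) ∧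
      ‖ψ g‖ ^ M.natDegree ≤ ‖eval (bk k) (M.coeff 0)‖ := by
    intro k
    obtain ⟨z, hz, hz2⟩ := small_root (M.map (eval (bk k))) (hM.map _) (by rw [hdeg]; exact hMd)
    rw [hdeg, Polynomial.coeff_map] at hz2
    let f : Polynomial (MvPolynomial (Fin m) ℂ) →ₐ[ℂ] A :=
      { Polynomial.eval₂RingHom ι.toRingHom g with
        commutes' := fun r => by
          change Polynomial.eval₂ ι.toRingHom g (Polynomial.C (C r)) = _
          rw [Polynomial.eval₂_C]
          exact ι.commutes r }
    let χ : Polynomial (MvPolynomial (Fin m) ℂ) →ₐ[ℂ] ℂ :=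
      { Polynomial.eval₂RingHom (eval (bk k)) z with
        commutes' := fun r => by
          change Polynomial.eval₂ (eval (bk k)) z (Polynomial.C (C r)) = _
          rw [Polynomial.eval₂_C]
          simp }
    have hfint : f.toRingHom.IsIntegral := by
      intro a
      obtain ⟨q, hq, hqa⟩ := hintg a
      refine ⟨q.map Polynomial.C, hq.map _, ?_⟩
      rw [Polynomial.eval₂_map]
      have : f.toRingHom.comp Polynomial.C = algebraMap _ A := by
        refine RingHom.ext fun s => ?_
        change Polynomial.eval₂ ι.toRingHom g (Polynomial.C s) = _
        rw [Polynomial.eval₂_C]; rfl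
      rw [this]; exact hqa
    obtain ⟨ψ, hψ⟩ := ext_hom' f hfint χ (by
      intro q hq
      have h1 : M ∣ q := minpoly.isIntegrallyClosed_dvd (hintg g) hq
      obtain ⟨r, rfl⟩ := h1
      rw [map_mul]
      have : χ M = 0 := by
        rw [Polynomial.eval_map] at hz
        exact hz
      rw [this, zero_mul])
    refine ⟨ψ, ?_, ?_⟩
    · ext i
      have h1 := DFunLike.congr_fun hψ (Polynomial.C (X i))
      have h2 : f (Polynomial.C (X i)) = ι (X i) := Polynomial.eval₂_C _ _
      have h3 : χ (Polynomial.C (X i)) = bk k i := (Polynomial.eval₂_C _ _).trans (by simp)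
      rw [AlgHom.comp_apply, h2, h3] at h1
      simpa using h1
    · have h1 := DFunLike.congr_fun hψ Polynomial.X
      have h2 : f Polynomial.X = g := Polynomial.eval₂_X _ _
      have h3 : χ Polynomial.X = z := Polynomial.eval₂_X _ _
      rw [AlgHom.comp_apply, h2, h3] at h1
      rw [h1]; exact hz2
  choose ψ hψb hψg using hex
  have hψι : ∀ k s, ψ k (ι s) = eval (bk k) s := by
    intro k s
    have := DFunLike.congr_fun (hψb k) s
    simpa [aeval_eq_eval] using this
  refine ⟨ψ, fun k h => ?_, fun a => ?_⟩
  · obtain ⟨q, hq⟩ := hwD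
    apply hDk k
    rw [← hψι, hq, map_mul, h, zero_mul]
  rw [tendsto_iff_ultrafilter]
  intro 𝒰 h𝒰
  have hlim : ∀ a, ∃ L, Tendsto (fun k => ψ k a) 𝒰 (𝓝 L) := by
    intro a
    let q := minpoly (MvPolynomial (Fin m) ℂ) a
    have hq : q.Monic := minpoly.monic (hintg a)
    have hbd : ∀ k, ‖ψ k a‖ ≤ ∑ i ∈ Finset.range q.natDegree, ‖eval (bk k) (q.coeff i)‖ + 1 := by
      intro k
      have := root_bound (q.map (eval (bk k))) (hq.map _) (ψ k a)
        (hrel (ψ k) (bk k) (hψb k) q a (minpoly.aeval _ a)) q.natDegree (hq.natDegree_map _)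
      simpa [Polynomial.coeff_map] using this
    have ht : Tendsto (fun k => ∑ i ∈ Finset.range q.natDegree, ‖eval (bk k) (q.coeff i)‖ + 1) atTop
        (𝓝 (∑ i ∈ Finset.range q.natDegree, ‖eval b (q.coeff i)‖ + 1)) :=
      (tendsto_finsetSum _ fun i _ => (hcont (q.coeff i)).norm).add_const 1
    set L0 := ∑ i ∈ Finset.range q.natDegree, ‖eval b (q.coeff i)‖ + 1
    have hev : ∀ᶠ k in (𝒰 : Filter ℕ), ψ k a ∈ Metric.closedBall (0:ℂ) (L0 + 1) := by
      apply h𝒰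
      filter_upwards [ht.eventually (gt_mem_nhds (lt_add_one L0))] with k hk
      rw [mem_closedBall_zero_iff]
      exact (hbd k).trans hk.le
    obtain ⟨L, _, hL⟩ := (isCompact_closedBall (0:ℂ) (L0 + 1)).ultrafilter_le_nhds'
      (𝒰.map fun k => ψ k a) hev
    exact ⟨L, hL⟩
  choose L hL using hlim
  let Λ : A →ₐ[ℂ] ℂ :=
    { toFun := L
      map_one' := tendsto_nhds_unique (hL 1) (by simp)
      map_zero' := tendsto_nhds_unique (hL 0) (by simp)
      map_add' := fun x y => tendsto_nhds_unique (hL (x + y)) (by simpa using (hL x).add (hL y))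
      map_mul' := fun x y => tendsto_nhds_unique (hL (x * y)) (by simpa using (hL x).mul (hL y))
      commutes' := fun r => tendsto_nhds_unique (hL _) (by simp) }
  have hΛ : Λ = φ := by
    apply hguniq
    · rw [hb]
      ext i
      have h1 := (hcont (X i)).mono_left h𝒰
      have h2 : Tendsto (fun k => ψ k (ι (X i))) 𝒰 (𝓝 (eval b (X i))) := by
        simpa only [hψι] using h1
      have := tendsto_nhds_unique (hL (ι (X i))) h2
      rw [eval_X] at this
      simpa using (show Λ (ι (X i)) = b i from this)
    · have h1 : Tendsto (fun k => ‖ψ k g‖ ^ M.natDegree) 𝒰 (𝓝 0) := by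
        have h2 : Tendsto (fun k => ‖eval (bk k) (M.coeff 0)‖) 𝒰 (𝓝 0) := by
          have := ((hcont (M.coeff 0)).norm).mono_left h𝒰
          rwa [hM0, norm_zero] at this
        exact squeeze_zero (fun _ => by positivity) hψg h2
      have h3 := (hL g).norm.pow M.natDegree
      have h4 := tendsto_nhds_unique h3 h1
      have h5 := eq_zero_of_pow_eq_zero h4
      exact norm_eq_zero.mp h5
  have := hL a
  rwa [show L a = φ a from DFunLike.congr_fun hΛ a] at this

lemma seq_lemma {R : Type} [CommRing R] [Algebra ℂ R] [Algebra.FiniteType ℂ R]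
    (φ : R →ₐ[ℂ] ℂ) (I : Ideal R) (w : R) (h : ¬ ∃ g N, φ g ≠ 0 ∧ g * w ^ N ∈ I) :
    ∃ ψ : ℕ → (R →ₐ[ℂ] ℂ), (∀ k, ∀ x ∈ I, ψ k x = 0) ∧ (∀ k, ψ k w ≠ 0) ∧
      ∀ a, Tendsto (fun k => ψ k a) atTop (𝓝 (φ a)) := by
  obtain ⟨Q, hQ, hIQ, hQφ, hw⟩ := exists_prime_sep φ I w h
  obtain ⟨ψ, h1, h2⟩ := seq_domain (Ideal.Quotient.liftₐ Q φ fun a ha => hQφ ha)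
    (Ideal.Quotient.mk Q w) (fun h => hw (Ideal.Quotient.eq_zero_iff_mem.mp h))
  refine ⟨fun k => (ψ k).comp (Ideal.Quotient.mkₐ ℂ Q), fun k x hx => ?_, h1, fun a => h2 _⟩
  change ψ k (Ideal.Quotient.mk Q x) = 0
  rw [Ideal.Quotient.eq_zero_iff_mem.mpr (hIQ hx), map_zero]

end PF

end

section

namespace PF

abbrev PS := PowerSeries ℂ
abbrev dX : Derivation ℂ PS PS := PowerSeries.derivative ℂ

lemma ps_eq_zero {f : PS} (h : dX f = 0) (h0 : PowerSeries.constantCoeff f = 0) : f = 0 :=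
  PowerSeries.derivative.ext (by rw [h, map_zero]) (by rw [h0, map_zero])

lemma chain_arc {σ : Type} [Fintype σ] (γ : MvPolynomial σ ℂ →ₐ[ℂ] PS) (p : MvPolynomial σ ℂ) :
    dX (γ p) = ∑ v, γ (pderiv v p) * dX (γ (X v)) := by
  classical
  induction p using MvPolynomial.induction_on with
  | C a => rw [algHom_C]; simp
  | add p q hp hq => simp only [map_add, hp, hq, add_mul, Finset.sum_add_distrib]
  | mul_X p v hp =>
    rw [map_mul, Derivation.leibniz, hp]
    simp only [Derivation.leibniz, pderiv_X, map_add, smul_eq_mul, map_mul, add_mul,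
      Finset.sum_add_distrib]
    congr 1
    · rw [Finset.sum_eq_single v]
      · simp
      · intro w _ hw
        simp [Pi.single_eq_of_ne hw.symm]
      · simp
    · rw [Finset.mul_sum]
      apply Finset.sum_congr rfl
      intros; ring

lemma arc_const {σ : Type} (γ : MvPolynomial σ ℂ →ₐ[ℂ] PS)
    (h : ∀ v, PowerSeries.constantCoeff (γ (X v)) = 0) (p : MvPolynomial σ ℂ) :
    PowerSeries.constantCoeff (γ p) = eval 0 p := by
  induction p using MvPolynomial.induction_on with
  | C a => rw [algHom_C]; simp [PowerSeries.algebraMap_apply]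
  | add p q hp hq => simp only [map_add, hp, hq]
  | mul_X p v hp => rw [map_mul, map_mul, h]; simp

lemma order_arg (a K u v c : PS) (ha : PowerSeries.constantCoeff a = 0)
    (hK0 : PowerSeries.constantCoeff K = 0) (hu : PowerSeries.constantCoeff u = 0)
    (hc : PowerSeries.constantCoeff c ≠ 0)
    (hK : dX K = u * dX a) (h : c * a + v * K = 0) : a = 0 := by
  have hcu : IsUnit c := by
    rw [PowerSeries.isUnit_iff_constantCoeff]; exact isUnit_iff_ne_zero.mpr hc
  have key : ∀ n, PowerSeries.X ^ (n + 1) ∣ a := by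
    intro n
    induction n with
    | zero => rw [zero_add, pow_one, PowerSeries.X_dvd_iff]; exact ha
    | succ n ih =>
      have h1 : PowerSeries.X ^ n ∣ dX a := by
        rw [PowerSeries.X_pow_dvd_iff] at ih ⊢
        intro m hm
        rw [PowerSeries.coeff_derivative, ih _ (by omega), zero_mul]
      have h2 : PowerSeries.X ^ (n + 1) ∣ dX K := by
        rw [hK, pow_succ']
        exact mul_dvd_mul (PowerSeries.X_dvd_iff.mpr hu) h1
      have h3 : PowerSeries.X ^ (n + 2) ∣ K := by
        rw [PowerSeries.X_pow_dvd_iff] at h2 ⊢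
        intro m hm
        cases m with
        | zero => simpa using hK0
        | succ m =>
          have := h2 m (by omega)
          rw [PowerSeries.coeff_derivative] at this
          exact (mul_eq_zero.mp this).resolve_right (by exact_mod_cast Nat.succ_ne_zero m)
      have h4 : PowerSeries.X ^ (n + 2) ∣ c * a := by
        rw [eq_neg_of_add_eq_zero_left h]
        exact (dvd_neg.mpr (h3.mul_left v))
      exact (hcu.dvd_mul_left).mp h4
  ext n
  have := (PowerSeries.X_pow_dvd_iff.mp (key n)) n (by omega)
  simpa using this

lemma C2 {n : ℕ} (H : MvPolynomial (Fin n) ℂ)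
    (hfin : {y : Fin n → ℂ | eval y H = 0 ∧ ∀ i, eval y (pderiv i H) = 0}.Finite)
    (h0 : eval 0 H = 0) (δ : MvPolynomial (Fin n) ℂ →ₐ[ℂ] PS)
    (hδ0 : ∀ i, PowerSeries.constantCoeff (δ (X i)) = 0)
    (hδ : ∀ i, δ (pderiv i H) = 0) (i : Fin n) : δ (X i) = 0 := by
  classical
  have hδH : δ H = 0 := by
    apply ps_eq_zero
    · rw [chain_arc]; simp [hδ]
    · rw [arc_const δ hδ0, h0]
  have hk : ∀ z : Fin n → ℂ, ∃ k, z ≠ 0 → z k ≠ 0 := by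
    intro z
    by_cases hz : z = 0
    · exact ⟨i, fun h => absurd hz h⟩
    · obtain ⟨k, hk⟩ := Function.ne_iff.mp hz
      exact ⟨k, fun _ => hk⟩
  choose k hk using hk
  let h : MvPolynomial (Fin n) ℂ := ∏ z ∈ hfin.toFinset.erase 0, (X (k z) - C (z (k z)))
  let I : Ideal (MvPolynomial (Fin n) ℂ) := Ideal.span (insert H (Set.range fun i => pderiv i H))
  have hmem : h * X i ∈ I.radical := by
    rw [← vanishingIdeal_zeroLocus_eq_radical (K := ℂ), mem_vanishingIdeal_iff]
    intro z hz
    rw [zeroLocus_span] at hz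
    have hz1 : eval z H = 0 := by simpa [aeval_eq_eval] using hz H (by simp)
    have hz2 : ∀ i, eval z (pderiv i H) = 0 := fun i => by
      simpa [aeval_eq_eval] using hz (pderiv i H) (by simp)
    rw [aeval_eq_eval]
    change eval z (h * X i) = 0
    rw [map_mul]
    by_cases hz0 : z = 0
    · simp [hz0]
    · have : eval z h = 0 := by
        simp only [h, map_prod]
        apply Finset.prod_eq_zero (i := z)
        · simp [hz0, hz1, hz2]
        · simp
      rw [this, zero_mul]
  obtain ⟨N, hN⟩ := hmem
  have hI : I ≤ RingHom.ker δ := by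
    rw [Ideal.span_le]
    rintro _ (rfl | ⟨i, rfl⟩)
    · exact hδH
    · exact hδ i
  have h1 : δ (h * X i) = 0 := by
    have : δ ((h * X i) ^ N) = 0 := hI hN
    rw [map_pow] at this
    exact eq_zero_of_pow_eq_zero this
  rw [map_mul] at h1
  refine (mul_eq_zero.mp h1).resolve_left fun h2 => ?_
  have h3 := arc_const δ hδ0 h
  rw [h2, map_zero] at h3
  symm at h3
  simp only [h, map_prod] at h3
  rw [Finset.prod_eq_zero_iff] at h3
  obtain ⟨z, hz, hz'⟩ := h3
  have := hk z (Finset.ne_of_mem_erase hz)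
  simp at hz'
  exact this hz'

/-- evaluation at `(0,t)` as algebra hom -/
def evqA {σ : Type} [Fintype σ] (t : ℂ) : MvPolynomial σ (Polynomial ℂ) →ₐ[ℂ] ℂ :=
  { evq t with
    commutes' := fun r => by
      change evq t (C (Polynomial.C r)) = r
      rw [evq_C]; simp }

lemma evqA_apply {σ : Type} [Fintype σ] (t : ℂ) (p : MvPolynomial σ (Polynomial ℂ)) :
    evqA t p = evq t p := rfl

lemma triv_of_arcs {σ : Type} [Fintype σ] (f : σ → MvPolynomial σ (Polynomial ℂ)) (t : ℂ)
    (h : ∀ γ : MvPolynomial σ (Polynomial ℂ) →ₐ[ℂ] PS,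
      (∀ v, PowerSeries.constantCoeff (γ v) = evq t v) → (∀ i, γ (f i) = 0) →
      ∀ v, γ (X v) = 0) : Triv f t := by
  have : Algebra.FiniteType ℂ (MvPolynomial σ (Polynomial ℂ)) :=
    Algebra.FiniteType.trans (S := Polynomial ℂ) inferInstance inferInstance
  refine combine (idealOfVars σ (Polynomial ℂ)) (Ideal.span (Set.range f)) (evq t) X rfl
    fun v => ?_
  obtain ⟨g, N, h1, h2⟩ := arc_lemma (evqA t) (Ideal.span (Set.range f)) (X v)
    (fun γ hγ hγI => h γ hγ (fun i => hγI _ (Ideal.subset_span ⟨i, rfl⟩)) v)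
  exact ⟨g, N, h1, h2⟩

/-- constant extension -/
def ec {σ : Type} : MvPolynomial σ ℂ →ₐ[ℂ] MvPolynomial σ (Polynomial ℂ) :=
  aeval X

lemma ec_X {σ : Type} (v : σ) : ec (X v : MvPolynomial σ ℂ) = X v := by simp [ec]

lemma sp_ec {σ : Type} [Fintype σ] (t : ℂ) (p : MvPolynomial σ ℂ) : sp t (ec p) = p := by
  have : (sp t).comp ec = AlgHom.id ℂ (MvPolynomial σ ℂ) := by
    ext v; simp [ec_X, sp_X]
  exact DFunLike.congr_fun this p

end PF

end

section

namespace PF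

/-- setting the parameter variable to zero -/
def z0 {n : ℕ} : MvPolynomial (Option (Fin n)) ℂ →ₐ[ℂ] MvPolynomial (Fin n) ℂ :=
  aeval fun o => o.elim 0 X

lemma z0_none {n : ℕ} : z0 (n := n) (X none) = 0 := by simp [z0]
lemma z0_some {n : ℕ} (i : Fin n) : z0 (X (some i)) = X i := by simp [z0]

lemma pderiv_z0 {n : ℕ} (i : Fin n) (p : MvPolynomial (Option (Fin n)) ℂ) :
    pderiv i (z0 p) = z0 (pderiv (some i) p) := by
  classical
  induction p using MvPolynomial.induction_on with
  | C a => rw [algHom_C]; simp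
  | add p q hp hq => simp only [map_add, hp, hq]
  | mul_X p v hp =>
    rw [map_mul, Derivation.leibniz, hp, Derivation.leibniz]
    simp only [smul_eq_mul, map_add, map_mul]
    congr 2
    cases v with
    | none => simp [z0_none, pderiv_X]
    | some k =>
      rw [z0_some, pderiv_X, pderiv_X]
      by_cases h : k = i
      · subst h; simp
      · rw [Pi.single_eq_of_ne h, Pi.single_eq_of_ne (by simpa using h)]; simp

lemma eval_z0 {n : ℕ} (y : Fin n → ℂ) (p : MvPolynomial (Option (Fin n)) ℂ) :
    eval y (z0 p) = eval (fun o => o.elim 0 y) p := by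
  have : (aeval y).comp z0 = (aeval (fun o : Option (Fin n) => o.elim 0 y) :
      MvPolynomial (Option (Fin n)) ℂ →ₐ[ℂ] ℂ) := by
    ext v; cases v <;> simp [z0_none, z0_some]
  have := DFunLike.congr_fun this p
  simpa [aeval_eq_eval] using this

lemma ker_z0 {n : ℕ} (p : MvPolynomial (Option (Fin n)) ℂ) (hp : z0 p = 0) :
    p ∈ Ideal.span {(X none : MvPolynomial (Option (Fin n)) ℂ)} := by
  let e : MvPolynomial (Fin n) ℂ →ₐ[ℂ] MvPolynomial (Option (Fin n)) ℂ := aeval fun i => X (some i)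
  have h : ∀ p, p - e (z0 p) ∈ Ideal.span {(X none : MvPolynomial (Option (Fin n)) ℂ)} := by
    intro p
    rw [← Ideal.Quotient.eq_zero_iff_mem, map_sub, sub_eq_zero]
    have : Ideal.Quotient.mkₐ ℂ (Ideal.span {(X none : MvPolynomial (Option (Fin n)) ℂ)})
      = ((Ideal.Quotient.mkₐ ℂ _).comp e).comp z0 := by
      ext v
      cases v with
      | none =>
        simp only [AlgHom.comp_apply, z0_none, map_zero]
        exact Ideal.Quotient.eq_zero_iff_mem.mpr (Ideal.mem_span_singleton_self _)
      | some i => simp [z0_some, e]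
    exact DFunLike.congr_fun this p
  have := h p
  rwa [hp, map_zero, sub_zero] at this

/-- an arc killing the parameter factors through `z0`. -/
lemma arc_factor {n : ℕ} (γ : MvPolynomial (Option (Fin n)) ℂ →ₐ[ℂ] PS) (h : γ (X none) = 0) :
    ∃ δ : MvPolynomial (Fin n) ℂ →ₐ[ℂ] PS, ∀ p, γ p = δ (z0 p) := by
  refine ⟨aeval fun i => γ (X (some i)), fun p => ?_⟩
  have : γ = (aeval fun i => γ (X (some i))).comp z0 := by
    ext1 v; cases v <;> simp [z0_none, z0_some, h]
  exact DFunLike.congr_fun this p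

lemma finrank_quot_map {R R' : Type} [CommRing R] [CommRing R'] [Algebra ℂ R] [Algebra ℂ R']
    (f : R →ₐ[ℂ] R') (hf : Function.Surjective f) (J : Ideal R) (hk : RingHom.ker f ≤ J) :
    Module.finrank ℂ (R ⧸ J) = Module.finrank ℂ (R' ⧸ J.map f) := by
  let g : R →ₐ[ℂ] R' ⧸ J.map f := (Ideal.Quotient.mkₐ ℂ _).comp f
  have hg : Function.Surjective g := Ideal.Quotient.mk_surjective.comp hf
  have hker : RingHom.ker g = J := by
    ext x
    have h1 : x ∈ RingHom.ker g ↔ f x ∈ J.map f := by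
      rw [RingHom.mem_ker]; exact Ideal.Quotient.eq_zero_iff_mem
    rw [h1, ← Ideal.mem_comap, Ideal.comap_map_of_surjective' f hf, sup_eq_left.mpr hk]
  have e := (Ideal.quotientKerAlgEquivOfSurjective hg).toLinearEquiv.finrank_eq
  rw [← e]
  exact (Ideal.quotientEquivAlgOfEq ℂ hker).toLinearEquiv.finrank_eq.symm

lemma HasMu.z0 {n : ℕ} {I : Ideal (MvPolynomial (Option (Fin n)) ℂ)} {v : ℕ} (h : HasMu I v)
    (hX : X none ∈ I) : HasMu (I.map z0) v := by
  have hs : Function.Surjective (PF.z0 (n := n)) := by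
    intro p
    refine ⟨aeval (fun i => X (some i)) p, ?_⟩
    have : PF.z0.comp (aeval (fun i => X (some i))) = AlgHom.id ℂ (MvPolynomial (Fin n) ℂ) := by
      ext1 i; simp [z0_some]
    exact DFunLike.congr_fun this p
  have hv : ∀ N, (I ⊔ idealOfVars (Option (Fin n)) ℂ ^ N).map PF.z0 = I.map PF.z0 ⊔ idealOfVars (Fin n) ℂ ^ N := by
    intro N
    rw [Ideal.map_sup, Ideal.map_pow]
    congr 2
    rw [idealOfVars, Ideal.map_span, idealOfVars]
    apply le_antisymm
    · rw [Ideal.span_le]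
      rintro _ ⟨_, ⟨o, rfl⟩, rfl⟩
      cases o with
      | none => rw [z0_none]; exact zero_mem _
      | some i => rw [z0_some]; exact Ideal.subset_span ⟨i, rfl⟩
    · rw [Ideal.span_le]
      rintro _ ⟨i, rfl⟩
      exact Ideal.subset_span ⟨_, ⟨some i, rfl⟩, z0_some i⟩
  obtain ⟨N, h1, h2⟩ := h
  refine ⟨N, ?_, ?_⟩
  · rw [← hv, ← hv, h1]
  · rw [← h2, DD, DD, ← hv]
    refine (finrank_quot_map PF.z0 hs _ fun p hp => ?_).symm
    refine Ideal.mem_sup_left ?_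
    have := ker_z0 p hp
    exact (Ideal.span_singleton_le_iff_mem I).mpr hX this

lemma C1 {n : ℕ} (F : MvPolynomial (Option (Fin n)) ℂ) (h0 : eval 0 F = 0)
    (hc : eval 0 (pderiv none F) ≠ 0)
    (hfin : {y : Fin n → ℂ | eval y (z0 F) = 0 ∧ ∀ i, eval y (pderiv i (z0 F)) = 0}.Finite) :
    ∃ v, HasMu (Ideal.span (Set.range fun o : Option (Fin n) =>
        o.elim F fun i => pderiv (some i) F)) v ∧
      HasMu (Ideal.span (Set.range fun i => pderiv i (z0 F))) v := by
  set c := eval 0 (pderiv none F) with hcdef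
  let f : Option (Fin n) → MvPolynomial (Option (Fin n)) (Polynomial ℂ) := fun o =>
    o.elim ((1 - C Polynomial.X) * ec F + C Polynomial.X * ec (C c * X none))
      (fun i => ec (pderiv (some i) F))
  have hz00 : eval 0 (z0 F) = 0 := by
    rw [eval_z0]
    have : (fun o : Option (Fin n) => o.elim 0 (0 : Fin n → ℂ)) = 0 := by
      ext o; cases o <;> rfl
    rw [this, h0]
  have htriv : ∀ τ, Triv f τ := by
    intro τ
    apply triv_of_arcs
    intro γ hγ0 hγf
    let γ' : MvPolynomial (Option (Fin n)) ℂ →ₐ[ℂ] PS := γ.comp ec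
    have hγ'X : ∀ v, γ' (X v) = γ (X v) := fun v => by simp [γ', ec_X]
    have hγ'0 : ∀ v, PowerSeries.constantCoeff (γ' (X v)) = 0 := fun v => by
      rw [hγ'X, hγ0, evq_X]
    have hγ'c := arc_const γ' hγ'0
    have hy : ∀ i, γ' (pderiv (some i) F) = 0 := fun i => hγf (some i)
    have hn := hγf none
    have hs : γ' (X none) = 0 := by
      refine order_arg (γ' (X none)) (γ' (F - C c * X none)) (γ' (pderiv none F - C c))
        (1 - γ (C Polynomial.X)) (γ' (C c)) (hγ'0 _) ?_ ?_ ?_ ?_ ?_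
      · rw [hγ'c, map_sub, h0]; simp
      · rw [hγ'c]; simp [hcdef]
      · rw [hγ'c]; simpa using hc
      · rw [chain_arc, Fintype.sum_option, Finset.sum_eq_zero, add_zero]
        · congr 2
          simp
        · intro i _
          have : pderiv (some i) (F - C c * X none) = pderiv (some i) F := by
            simp
          rw [this, hy, zero_mul]
      · have h1 : (1 - γ (C Polynomial.X)) * γ' F + γ (C Polynomial.X) * γ' (C c * X none) = 0 := by
          rw [← hn]; simp [f, γ']
        rw [map_sub]
        rw [map_mul] at h1 ⊢
        linear_combination h1
    obtain ⟨δ, hδ⟩ := arc_factor γ' hs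
    intro v
    rw [← hγ'X]
    cases v with
    | none => exact hs
    | some i =>
      rw [hδ, z0_some]
      refine C2 (z0 F) hfin hz00 δ (fun k => ?_) (fun k => ?_) i
      · rw [← z0_some, ← hδ]; exact hγ'0 _
      · rw [pderiv_z0, ← hδ]; exact hy k
  obtain ⟨v, hv, hvmin⟩ := T1 (htriv 0)
  obtain ⟨v', hv', hvmin'⟩ := T1 (htriv 1)
  have hvv : v = v' := le_antisymm (hvmin _ _ hv') (hvmin' _ _ hv)
  subst hvv
  have hmap : ∀ t, (Ideal.span (Set.range f)).map (sp t) = Ideal.span (Set.range fun o => sp t (f o)) := by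
    intro t
    rw [Ideal.map_span, ← Set.range_comp]; rfl
  rw [hmap] at hv hv'
  refine ⟨v, ?_, ?_⟩
  · convert hv using 4 with o
    cases o with
    | none => simp [f, sp_ec, sp_C]
    | some i => simp [f, sp_ec]
  · have h1 : X none ∈ Ideal.span (Set.range fun o => sp 1 (f o)) := by
      have h2 : sp 1 (f none) ∈ Ideal.span (Set.range fun o => sp 1 (f o)) :=
        Ideal.subset_span ⟨none, rfl⟩
      have h3 : sp 1 (f none) = C c * X none := by
        simp only [f, Option.elim_none, map_add, map_mul, map_sub, map_one, sp_C, sp_ec]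
        simp
      rw [h3] at h2
      have h4 := Ideal.mul_mem_left _ (C c⁻¹) h2
      rwa [← mul_assoc, ← C_mul, inv_mul_cancel₀ hc, C_1, one_mul] at h4
    have h2 := hv'.z0 h1
    have h3 : (Ideal.span (Set.range fun o => sp 1 (f o))).map z0 =
        Ideal.span (Set.range fun i => pderiv i (z0 F)) := by
      rw [Ideal.map_span]
      apply le_antisymm
      · rw [Ideal.span_le]
        rintro _ ⟨_, ⟨o, rfl⟩, rfl⟩
        cases o with
        | none =>
          have : z0 (sp 1 (f none)) = 0 := by
            simp only [f, Option.elim_none, map_add, map_mul, map_sub, map_one, sp_C, ec_X, sp_X, z0_none]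
            simp
          simp only [this]
          exact zero_mem _
        | some i =>
          apply Ideal.subset_span
          exact ⟨i, by simp [f, sp_ec, pderiv_z0]⟩
      · rw [Ideal.span_le]
        rintro _ ⟨i, rfl⟩
        apply Ideal.subset_span
        exact ⟨_, ⟨some i, rfl⟩, by simp [f, sp_ec, pderiv_z0]⟩
    rwa [h3] at h2

end PF

end

section

namespace PF

def FT {n : ℕ} (G : MvPolynomial (Option (Fin n)) ℂ) (j : Fin n) (d : ℕ) (t : ℂ) :
    MvPolynomial (Option (Fin n)) ℂ := G - C t * X (some j) ^ d

def famN {n : ℕ} (G : MvPolynomial (Option (Fin n)) ℂ) (j : Fin n) (d : ℕ) :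
    Option (Fin n) → MvPolynomial (Option (Fin n)) (Polynomial ℂ) := fun o =>
  o.elim (ec G - C Polynomial.X * ec (X (some j) ^ d))
    (fun i => ec (pderiv (some i) G) - C Polynomial.X * ec (pderiv (some i) (X (some j) ^ d)))

lemma sp_fam {n : ℕ} (G : MvPolynomial (Option (Fin n)) ℂ) (j : Fin n) (d : ℕ) (t : ℂ)
    (o : Option (Fin n)) :
    sp t (famN G j d o) = o.elim (FT G j d t) fun i => pderiv (some i) (FT G j d t) := by
  cases o with
  | none =>
    simp only [famN, Option.elim_none, map_sub, map_mul, sp_ec, sp_C, FT]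
    simp
  | some i =>
    simp only [famN, Option.elim_some, map_sub, map_mul, sp_ec, sp_C, FT, pderiv_C_mul]
    simp

/-- evaluation at `(y,t)` -/
def evYT {σ : Type} (y : σ → ℂ) (t : ℂ) : MvPolynomial σ (Polynomial ℂ) →+* ℂ :=
  eval₂Hom (Polynomial.evalRingHom t) y

lemma evYT_eq {σ : Type} [Fintype σ] (y : σ → ℂ) (t : ℂ) (p : MvPolynomial σ (Polynomial ℂ)) :
    evYT y t p = eval y (sp t p) := by
  have : evYT y t = (eval y).comp (sp t : MvPolynomial σ (Polynomial ℂ) →ₐ[ℂ] MvPolynomial σ ℂ).toRingHom := by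
    ext q
    · simp [evYT, sp_C]
    · simp [evYT, sp_C]
    · simp [evYT, sp_X]
  rw [this]; rfl

lemma evYT_zero {σ : Type} [Fintype σ] (t : ℂ) (p : MvPolynomial σ (Polynomial ℂ)) :
    evYT 0 t p = evq t p := by
  rw [evYT_eq, eval_zero, constCoeff_sp]

lemma evYT_tendsto {σ : Type} [Fintype σ] (y : ℕ → σ → ℂ) (t : ℕ → ℂ) (y0 : σ → ℂ) (t0 : ℂ)
    (hy : Tendsto y atTop (𝓝 y0)) (ht : Tendsto t atTop (𝓝 t0))
    (p : MvPolynomial σ (Polynomial ℂ)) :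
    Tendsto (fun k => evYT (y k) (t k) p) atTop (𝓝 (evYT y0 t0 p)) := by
  induction p using MvPolynomial.induction_on with
  | C a =>
    simp only [evYT, coe_eval₂Hom, eval₂_C, Polynomial.coe_evalRingHom]
    exact (a.continuous.tendsto t0).comp ht
  | add p q hp hq => simp only [map_add]; exact hp.add hq
  | mul_X p v hp =>
    simp only [map_mul]
    refine hp.mul ?_
    simp only [evYT, coe_eval₂Hom, eval₂_X]
    exact (tendsto_pi_nhds.mp hy) v

theorem abs_main {n d : ℕ} (hd : 2 ≤ d) (G : MvPolynomial (Option (Fin n)) ℂ) (j : Fin n)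
    (h0 : eval 0 G = 0) (hc : eval 0 (pderiv none G) ≠ 0)
    (hfin : ∀ t, {y : Fin n → ℂ | eval y (z0 (FT G j d t)) = 0 ∧
      ∀ i, eval y (pderiv i (z0 (FT G j d t))) = 0}.Finite)
    (ν : ℂ → ℕ) (hν : ∀ t, ν t = Module.finrank ℂ (MvPowerSeries (Fin n) ℂ ⧸ Ideal.span
      ((fun g => (coeToMvPowerSeries.ringHom g : MvPowerSeries (Fin n) ℂ)) ''
        Set.range fun i => pderiv i (z0 (FT G j d t))))) (t0 : ℂ) :
    (∃ t, ν t < ν t0) ↔ ∃ (y : ℕ → Option (Fin n) → ℂ) (t : ℕ → ℂ),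
      Tendsto y atTop (𝓝 0) ∧ Tendsto t atTop (𝓝 t0) ∧
      ∀ k, y k (some j) ≠ 0 ∧ eval (y k) (FT G j d (t k)) = 0 ∧
        ∀ i, eval (y k) (pderiv (some i) (FT G j d (t k))) = 0 := by
  have hFT0 : ∀ t, eval 0 (FT G j d t) = 0 := by
    intro t
    rw [FT, map_sub, h0, map_mul, map_pow, eval_X]
    simp [show d ≠ 0 by omega]
  have hFTc : ∀ t, eval 0 (pderiv none (FT G j d t)) ≠ 0 := by
    intro t
    have : pderiv none (FT G j d t) = pderiv none G := by
      rw [FT, map_sub, pderiv_C_mul, pderiv_pow]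
      simp [pderiv_X]
    rw [this]; exact hc
  have hz00 : ∀ t, eval 0 (z0 (FT G j d t)) = 0 := by
    intro t
    rw [eval_z0]
    have : (fun o : Option (Fin n) => o.elim 0 (0 : Fin n → ℂ)) = 0 := by
      ext o; cases o <;> rfl
    rw [this, hFT0]
  set I := Ideal.span (Set.range (famN G j d)) with hI
  have hmu : ∀ t, HasMu (I.map (sp t)) (ν t) := by
    intro t
    obtain ⟨v, h1, h2⟩ := C1 (FT G j d t) (hFT0 t) (hFTc t) (hfin t)
    have h3 := h2.finrank_ps
    rw [hν, h3, hI, Ideal.map_span, ← Set.range_comp]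
    convert h1 using 3
    ext o : 1
    exact sp_fam G j d t o
  constructor
  · rintro ⟨t1, ht1⟩
    have hnt : ¬ Triv (famN G j d) t0 := by
      intro h
      obtain ⟨v, hv, hmin⟩ := T1 h
      have h1 := hv.unique (hmu t0)
      have h2 := hmin t1 _ (hmu t1)
      omega
    have hng : ¬ ∃ g N, evqA t0 g ≠ 0 ∧ g * X (some j) ^ N ∈ I := by
      rintro ⟨g, N, hg, hgN⟩
      apply hnt
      apply triv_of_arcs
      intro γ hγ0 hγf
      have hyj : γ (X (some j)) = 0 := by
        have h1 : γ (g * X (some j) ^ N) = 0 := by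
          have : I ≤ RingHom.ker γ := by
            rw [hI, Ideal.span_le]; rintro _ ⟨o, rfl⟩; exact hγf o
          exact this hgN
        rw [map_mul, map_pow] at h1
        rcases mul_eq_zero.mp h1 with h2 | h2
        · exfalso; apply hg
          rw [evqA_apply, ← hγ0, h2, map_zero]
        · exact eq_zero_of_pow_eq_zero h2
      let γ' : MvPolynomial (Option (Fin n)) ℂ →ₐ[ℂ] PS := γ.comp ec
      have hγ'X : ∀ v, γ' (X v) = γ (X v) := fun v => by simp [γ', ec_X]
      have hγ'0 : ∀ v, PowerSeries.constantCoeff (γ' (X v)) = 0 := fun v => by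
        rw [hγ'X, hγ0, evq_X]
      have hγ'c := arc_const γ' hγ'0
      have hXd : γ' (X (some j) ^ d) = 0 := by
        rw [map_pow, hγ'X, hyj, zero_pow (by omega)]
      have hXd' : ∀ i, γ' (pderiv (some i) (X (some j) ^ d)) = 0 := by
        intro i
        rw [pderiv_pow, map_mul, map_mul, map_pow, hγ'X, hyj, zero_pow (by omega)]
        simp
      have hG : γ' G = 0 := by
        have h1 := hγf none
        simp only [famN, Option.elim_none, map_sub, map_mul] at h1
        rw [show γ (ec (X (some j) ^ d)) = 0 from hXd, mul_zero, sub_zero] at h1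
        exact h1
      have hGy : ∀ i, γ' (pderiv (some i) G) = 0 := by
        intro i
        have h1 := hγf (some i)
        simp only [famN, Option.elim_some, map_sub, map_mul] at h1
        rw [show γ (ec (pderiv (some i) (X (some j) ^ d))) = 0 from hXd' i, mul_zero, sub_zero] at h1
        exact h1
      have hs : γ' (X none) = 0 := by
        apply ps_eq_zero _ (hγ'0 _)
        have h1 := chain_arc γ' G
        rw [hG, map_zero, Fintype.sum_option, Finset.sum_eq_zero (fun i _ => by rw [hGy, zero_mul]),
          add_zero] at h1
        refine (mul_eq_zero.mp h1.symm).resolve_left fun h2 => hc ?_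
        rw [← hγ'c, h2, map_zero]
      obtain ⟨δ, hδ⟩ := arc_factor γ' hs
      intro v
      rw [← hγ'X]
      cases v with
      | none => exact hs
      | some i =>
        rw [hδ, z0_some]
        refine C2 (z0 (FT G j d t0)) (hfin t0) (hz00 t0) δ (fun k => ?_) (fun k => ?_) i
        · rw [← z0_some, ← hδ]; exact hγ'0 _
        · rw [pderiv_z0, ← hδ, FT, map_sub, pderiv_C_mul, map_sub, hGy, map_mul, hXd', mul_zero, sub_zero]
    have : Algebra.FiniteType ℂ (MvPolynomial (Option (Fin n)) (Polynomial ℂ)) :=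
      Algebra.FiniteType.trans (S := Polynomial ℂ) inferInstance inferInstance
    obtain ⟨ψ, hψI, hψw, hψ⟩ := seq_lemma (evqA t0) I (X (some j)) hng
    have hψe : ∀ k, (ψ k : _ →+* ℂ) = evYT (fun v => ψ k (X v)) (ψ k (C Polynomial.X)) := by
      intro k
      ext q
      · have h1 : ψ k (algebraMap ℂ _ q) = q := (ψ k).commutes q
        refine Eq.trans (show _ = q from h1) ?_
        simp [evYT]
      · simp [evYT]
      · simp [evYT]
    have hz : ∀ k o, eval (fun v => ψ k (X v)) (sp (ψ k (C Polynomial.X)) (famN G j d o)) = 0 := by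
      intro k o
      rw [← evYT_eq, ← hψe]
      exact hψI k _ (Ideal.subset_span ⟨o, rfl⟩)
    refine ⟨fun k v => ψ k (X v), fun k => ψ k (C Polynomial.X), ?_, ?_, fun k => ⟨hψw k, ?_, fun i => ?_⟩⟩
    · rw [tendsto_pi_nhds]
      intro v
      have := hψ (X v)
      rwa [evqA_apply, evq_X] at this
    · have := hψ (C Polynomial.X)
      rwa [evqA_apply, evq_C, Polynomial.eval_X] at this
    · have := hz k none
      rwa [sp_fam] at this
    · have := hz k (some i)
      rwa [sp_fam] at this
  · rintro ⟨y, t, hy, ht, hk⟩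
    by_contra hcon
    push Not at hcon
    obtain ⟨g, N, hg, hgN⟩ := T2 (hmu t0) (fun t w hw => by
      rw [hw.unique (hmu t)]; exact hcon t)
    have h1 := hgN (X (some j) ^ N) (Ideal.pow_mem_pow (show X (some j) ∈ idealOfVars (Option (Fin n)) (Polynomial ℂ) from Ideal.subset_span ⟨some j, rfl⟩) N)
    have h2 := evYT_tendsto y t 0 t0 hy ht g
    rw [evYT_zero] at h2
    obtain ⟨k, hk1⟩ := (h2.eventually_ne hg).exists
    obtain ⟨hyj, hF, hFy⟩ := hk k
    have h3 : I ≤ RingHom.ker (evYT (y k) (t k)) := by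
      rw [hI, Ideal.span_le]
      rintro _ ⟨o, rfl⟩
      change evYT (y k) (t k) _ = 0
      rw [evYT_eq, sp_fam]
      cases o with
      | none => exact hF
      | some i => exact hFy i
    have h4 : evYT (y k) (t k) (g * X (some j) ^ N) = 0 := h3 h1
    rw [map_mul, map_pow] at h4
    rcases mul_eq_zero.mp h4 with h5 | h5
    · exact hk1 h5
    · apply hyj
      have := eq_zero_of_pow_eq_zero h5
      simpa [evYT] using this

end PF

end

section

namespace PF

lemma pderiv_aeval_chain {σ τ : Type} [Fintype σ] (g : σ → MvPolynomial τ ℂ) (o : τ)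
    (p : MvPolynomial σ ℂ) :
    pderiv o (aeval g p) = ∑ v, aeval g (pderiv v p) * pderiv o (g v) := by
  classical
  induction p using MvPolynomial.induction_on with
  | C a => simp
  | add p q hp hq => simp only [map_add, hp, hq, add_mul, Finset.sum_add_distrib]
  | mul_X p v hp =>
    rw [map_mul, Derivation.leibniz, hp]
    simp only [Derivation.leibniz, pderiv_X, map_add, smul_eq_mul, map_mul, add_mul,
      Finset.sum_add_distrib, aeval_X]
    congr 1
    · rw [Finset.sum_eq_single v]
      · simp
      · intro b _ hb; simp [Pi.single_eq_of_ne hb.symm]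
      · simp
    · rw [Finset.mul_sum]
      exact Finset.sum_congr rfl fun _ _ => by ring

lemma eval_aeval {σ τ : Type} (g : σ → MvPolynomial τ ℂ) (y : τ → ℂ) (p : MvPolynomial σ ℂ) :
    eval y (aeval g p) = eval (fun v => eval y (g v)) p := by
  induction p using MvPolynomial.induction_on with
  | C a => simp
  | add p q hp hq => simp only [map_add, hp, hq]
  | mul_X p v hp => simp only [map_mul, hp, aeval_X, eval_X]

lemma eval_pderiv_aeval {σ τ : Type} [Fintype σ] (g : σ → MvPolynomial τ ℂ) (o : τ) (y : τ → ℂ)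
    (p : MvPolynomial σ ℂ) :
    eval y (pderiv o (aeval g p)) =
      ∑ v, eval (fun v => eval y (g v)) (pderiv v p) * eval y (pderiv o (g v)) := by
  rw [pderiv_aeval_chain, map_sum]
  simp only [map_mul, eval_aeval]

lemma aeval_wh {σ τ : Type} [Fintype σ] {w : σ → ℕ} {w' : τ → ℕ} {m : ℕ} {p : MvPolynomial σ ℂ}
    (hp : p.IsWeightedHomogeneous w m) (g : σ → MvPolynomial τ ℂ)
    (hg : ∀ v, (g v).IsWeightedHomogeneous w' (w v)) :
    (aeval g p).IsWeightedHomogeneous w' m := by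
  rw [aeval_def, eval₂_eq']
  refine IsWeightedHomogeneous.sum _ _ _ fun e he => ?_
  have h1 : Finsupp.weight w e = m := hp (mem_support_iff.mp he)
  refine IsWeightedHomogeneous.C_mul ?_ _
  have h2 := IsWeightedHomogeneous.prod (w := w') Finset.univ (fun v => g v ^ e v)
    (fun v => e v • w v) (fun v _ => (hg v).pow (e v))
  rw [← h1, Finsupp.weight_apply, Finsupp.sum_fintype _ _ (by simp)]
  exact h2

lemma eval_wh {σ : Type} [Fintype σ] {w : σ → ℕ} {m : ℕ} {p : MvPolynomial σ ℂ}
    (hp : p.IsWeightedHomogeneous w m) (c : ℂ) (y : σ → ℂ) :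
    eval (fun v => c ^ w v * y v) p = c ^ m * eval y p := by
  rw [eval_eq', eval_eq', Finset.mul_sum]
  refine Finset.sum_congr rfl fun e he => ?_
  have h1 : Finsupp.weight w e = m := hp (mem_support_iff.mp he)
  rw [Finsupp.weight_apply, Finsupp.sum_fintype _ _ (by simp)] at h1
  simp only [mul_pow, Finset.prod_mul_distrib, ← pow_mul, ← h1, Finset.prod_pow_eq_pow_sum]
  simp only [smul_eq_mul, mul_comm (w _)]
  ring

variable {n d : ℕ} {P : MvPolynomial (XS n) ℂ}

def wT (n : ℕ) : TV n → ℕ := Sum.elim (fun _ => 1) ![1, 0, 0]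

lemma xpart_wh (P : MvPolynomial (XS n) ℂ) (q : ℕ) :
    (xpart P q).IsWeightedHomogeneous (wtx n) q :=
  weightedHomogeneousComponent_isWeightedHomogeneous _ _

lemma FY_wh (d : ℕ) (P : MvPolynomial (XS n) ℂ) : (FY d P).IsWeightedHomogeneous (wT n) d := by
  unfold FY
  have hX0 : (X (Sum.inr 0) : MvPolynomial (TV n) ℂ).IsWeightedHomogeneous (wT n) 1 :=
    isWeightedHomogeneous_X ℂ (wT n) (Sum.inr 0)
  refine IsWeightedHomogeneous.sub (IsWeightedHomogeneous.sum _ _ _ fun q hq => ?_) ?_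
  · have hq' : q ≤ d := by simpa [Nat.lt_succ_iff] using hq
    have h1 := (hX0.pow (d - q)).mul (aeval_wh (w' := wT n) (xpart_wh P q) embT (by
      rintro (i | i)
      · exact isWeightedHomogeneous_X ℂ (wT n) (Sum.inl i)
      · exact isWeightedHomogeneous_X ℂ (wT n) (Sum.inr 1)))
    have : (d - q) • 1 + q = d := by simp; omega
    rwa [this] at h1
  · have h1 := (isWeightedHomogeneous_X ℂ (wT n) (Sum.inr 2)).mul (hX0.pow d)
    have : wT n (Sum.inr 2) + d • 1 = d := by simp [wT]
    rwa [this] at h1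

lemma evT_smul (c : ℂ) (u : HV n → ℂ) (s t : ℂ) :
    evT (c • u) s t = fun v => c ^ wT n v * evT u s t v := by
  ext v
  rcases v with i | i
  · simp [evT, wT]
  · fin_cases i <;> simp [evT, wT]

lemma FY_smul (c : ℂ) (u : HV n → ℂ) (s t : ℂ) :
    eval (evT (c • u) s t) (FY d P) = c ^ d * eval (evT u s t) (FY d P) := by
  rw [evT_smul, eval_wh (FY_wh d P)]

lemma FYs_smul (c : ℂ) (u : HV n → ℂ) (s t : ℂ) :
    eval (evT (c • u) s t) (pderiv (Sum.inr 1) (FY d P)) =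
      c ^ d * eval (evT u s t) (pderiv (Sum.inr 1) (FY d P)) := by
  rw [evT_smul, eval_wh ((FY_wh d P).pderiv (n' := d) (by simp [wT]))]

lemma FYi_smul (hd : 2 ≤ d) (c : ℂ) (u : HV n → ℂ) (s t : ℂ) (v : TV n) (hv : wT n v = 1) :
    eval (evT (c • u) s t) (pderiv v (FY d P)) =
      c ^ (d - 1) * eval (evT u s t) (pderiv v (FY d P)) := by
  rw [evT_smul, eval_wh ((FY_wh d P).pderiv (n' := d - 1) (by omega))]

lemma OnY_smul {c : ℂ} (hc : c ≠ 0) (u : HV n → ℂ) (s t : ℂ) :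
    OnY d P (c • u) s t ↔ OnY d P u s t := by
  unfold OnY
  rw [FY_smul]; simp [hc]

lemma Fib_smul (hd : 2 ≤ d) {c : ℂ} (hc : c ≠ 0) (u : HV n → ℂ) (s t : ℂ) :
    FiberDerivsVanish d P (c • u) s t ↔ FiberDerivsVanish d P u s t := by
  unfold FiberDerivsVanish
  rw [FYi_smul hd c u s t (Sum.inr 0) (by simp [wT])]
  simp only [fun i => FYi_smul (P := P) hd c u s t (Sum.inl i) (by simp [wT])]
  simp [hc]

lemma euler_FY (u : HV n → ℂ) (s t : ℂ) :
    (∑ i, u (Sum.inl i) * eval (evT u s t) (pderiv (Sum.inl i) (FY d P))) +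
      u (Sum.inr ()) * eval (evT u s t) (pderiv (Sum.inr 0) (FY d P)) =
      d * eval (evT u s t) (FY d P) := by
  have h := congrArg (eval (evT u s t)) (FY_wh d P).sum_weight_X_mul_pderiv
  rw [map_sum, Fintype.sum_sum_type] at h
  simpa [wT, evT, Fin.sum_univ_three] using h

/-- point of `ℂ^{n+1}` -/
def hv (x : Fin n → ℂ) (x0 : ℂ) : HV n → ℂ := Sum.elim x fun _ => x0

lemma P_eq_sum (hdeg : ∃ ε > (0:ℝ), ∀ s : ℂ, ‖s‖ < ε → DegXAt d P s) :
    P = ∑ q ∈ Finset.range (d + 1), xpart P q := by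
  obtain ⟨ε, hε, h⟩ := hdeg
  have hz : ∀ q, d < q → xpart P q = 0 := by
    intro q hq
    refine MvPolynomial.funext_set (fun v => Sum.elim (fun _ => Set.univ)
      (fun _ => {s : ℂ | ‖s‖ < ε}) v) ?_ ?_
    · rintro (i | i)
      · exact Set.infinite_univ
      · have : Set.Infinite (Metric.ball (0:ℂ) ε) :=
          infinite_of_mem_nhds 0 (Metric.ball_mem_nhds 0 hε)
        convert this using 1
        ext; simp
    · intro x hx
      have h1 := (h (x (Sum.inr ())) (hx (Sum.inr ()) trivial)).1 q hq fun i => x (Sum.inl i)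
      have h2 : evA (fun i => x (Sum.inl i)) (x (Sum.inr ())) = x := by
        ext v; rcases v with i | i <;> rfl
      rw [h2] at h1
      rw [h1, map_zero]
  have h1 := finsum_weightedHomogeneousComponent (wtx n) P
  conv_lhs => rw [← h1]
  rw [finsum_eq_sum_of_support_subset]
  · rfl
  · intro q hq
    by_contra hq'
    apply hq
    refine hz q ?_
    simpa using hq'

lemma FY_aff (hdeg : ∃ ε > (0:ℝ), ∀ s : ℂ, ‖s‖ < ε → DegXAt d P s) (t : ℂ) :
    aeval (Sum.elim (fun i => X (Sum.inl i)) ![1, X (Sum.inr ()), C t] :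
      TV n → MvPolynomial (XS n) ℂ) (FY d P) = P - C t := by
  conv_rhs => rw [P_eq_sum hdeg]
  rw [FY, map_sub, map_sum]
  congr 1
  · refine Finset.sum_congr rfl fun q _ => ?_
    rw [map_mul, map_pow, aeval_X]
    simp only [Sum.elim_inr, Matrix.cons_val_zero, one_pow, one_mul]
    rw [← AlgHom.comp_apply]
    conv_rhs => rw [← AlgHom.id_apply (R := ℂ) (xpart P q)]
    congr 1
    ext v : 1
    rcases v with i | i <;> simp [embT]
  · simp

lemma evA_aff (x : Fin n → ℂ) (s t : ℂ) : (fun v => eval (evA x s)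
    ((Sum.elim (fun i => X (Sum.inl i)) ![1, X (Sum.inr ()), C t] :
      TV n → MvPolynomial (XS n) ℂ) v)) = evT (hv x 1) s t := by
  ext v
  rcases v with i | i
  · simp [evA, evT, hv]
  · fin_cases i <;> simp [evA, evT, hv]

lemma aff_iff (hdeg : ∃ ε > (0:ℝ), ∀ s : ℂ, ‖s‖ < ε → DegXAt d P s) (x : Fin n → ℂ) (s t : ℂ) :
    (OnY d P (hv x 1) s t ∧ FiberDerivsVanish d P (hv x 1) s t) ↔
      (CritPt P x s ∧ eval (evA x s) P = t) := by
  have h1 : eval (evT (hv x 1) s t) (FY d P) = eval (evA x s) P - t := by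
    rw [← evA_aff, ← eval_aeval, FY_aff hdeg]; simp
  have h2 : ∀ i, eval (evT (hv x 1) s t) (pderiv (Sum.inl i) (FY d P)) =
      eval (evA x s) (pderiv (Sum.inl i) P) := by
    intro i
    have h3 := eval_pderiv_aeval (Sum.elim (fun i => X (Sum.inl i)) ![1, X (Sum.inr ()), C t] :
      TV n → MvPolynomial (XS n) ℂ) (Sum.inl i) (evA x s) (FY d P)
    rw [FY_aff hdeg, evA_aff] at h3
    simp only [map_sub, pderiv_C, map_zero, sub_zero] at h3
    rw [h3, Finset.sum_eq_single (Sum.inl i)]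
    · simp
    · rintro (k | k) _ hk
      · have : k ≠ i := fun h => hk (by rw [h])
        simp [pderiv_X, Pi.single_apply, this.symm, this]
      · fin_cases k <;> simp [pderiv_X]
    · simp
  have h3 := euler_FY (d := d) (P := P) (hv x 1) s t
  unfold OnY FiberDerivsVanish CritPt
  simp only [h2, h1] at h3 ⊢
  constructor
  · rintro ⟨a, b, -⟩; exact ⟨b, sub_eq_zero.mp a⟩
  · rintro ⟨a, b⟩
    refine ⟨sub_eq_zero.mpr b, a, ?_⟩
    simp only [a, b] at h3
    simpa [hv] using h3

end PF

end

section

namespace PF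
variable {n d : ℕ} {P : MvPolynomial (XS n) ℂ}

lemma aeval_emb_ne (p : MvPolynomial (XS n) ℂ) (k : Fin 3) (hk : k ≠ 1) :
    pderiv (Sum.inr k) (aeval (embT (n := n)) p) = 0 := by
  rw [pderiv_aeval_chain]
  refine Finset.sum_eq_zero fun v _ => ?_
  rcases v with i | i
  · simp [embT, pderiv_X]
  · simp [embT, pderiv_X, hk.symm]

lemma evT_emb (x : Fin n → ℂ) (x0 s t : ℂ) :
    (fun v => eval (evT (hv x x0) s t) (embT v)) = evA x s := by
  ext v
  rcases v with i | i <;> simp [embT, evT, hv, evA]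

/-- value at infinity -/
lemma inf_F (hd : 2 ≤ d) (x : Fin n → ℂ) (s t : ℂ) :
    eval (evT (hv x 0) s t) (FY d P) = eval (evA x s) (xpart P d) := by
  rw [FY, map_sub, map_sum, Finset.sum_eq_single d]
  · rw [map_mul, eval_aeval, evT_emb]
    simp [evT, hv, show d ≠ 0 by omega]
  · intro q hq hqd
    have : d - q ≠ 0 := by simp at hq; omega
    simp [evT, hv, this]
  · simp

lemma inf_Fi (hd : 2 ≤ d) (x : Fin n → ℂ) (s t : ℂ) (i : Fin n) :
    eval (evT (hv x 0) s t) (pderiv (Sum.inl i) (FY d P)) =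
      eval (evA x s) (pderiv (Sum.inl i) (xpart P d)) := by
  rw [FY, map_sub, map_sum, map_sub, map_sum, Finset.sum_eq_single d]
  · rw [Derivation.leibniz, Derivation.leibniz, pderiv_pow, pderiv_pow]
    simp only [Nat.sub_self, pow_zero, Nat.cast_zero, zero_mul, smul_zero, add_zero, one_smul]
    rw [eval_pderiv_aeval, evT_emb, Finset.sum_eq_single (Sum.inl i)]
    · simp [embT, pderiv_X, evT, hv, show d - 1 ≠ 0 by omega, show d ≠ 0 by omega]
    · rintro (k | k) _ hk
      · have : k ≠ i := fun h => hk (by rw [h])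
        simp [pderiv_X, embT, this]
      · simp [pderiv_X, embT]
    · simp
  · intro q hq hqd
    have : d - q ≠ 0 := by simp at hq; omega
    rw [Derivation.leibniz, pderiv_pow]
    simp [evT, hv, this, pderiv_X]
  · simp

lemma inf_F0 (hd : 2 ≤ d) (x : Fin n → ℂ) (s t : ℂ) :
    eval (evT (hv x 0) s t) (pderiv (Sum.inr 0) (FY d P)) = eval (evA x s) (xpart P (d - 1)) := by
  rw [FY, map_sub, map_sum, map_sub, map_sum, Finset.sum_eq_single (d - 1)]
  · rw [Derivation.leibniz, Derivation.leibniz, pderiv_pow, pderiv_pow, aeval_emb_ne _ _ (by decide)]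
    have h1 : d - (d - 1) = 1 := by omega
    rw [h1]
    simp only [smul_eq_mul, map_add, map_mul, eval_aeval, evT_emb]
    simp [evT, hv, show d - 1 ≠ 0 by omega, show d ≠ 0 by omega]
  · intro q hq hqd
    rw [Derivation.leibniz, pderiv_pow, aeval_emb_ne _ _ (by decide)]
    rcases Nat.eq_or_lt_of_le (show q ≤ d by simpa [Nat.lt_succ_iff] using hq) with h | h
    · simp [h]
    · have : d - q - 1 ≠ 0 := by omega
      simp [evT, hv, this]
  · intro h; exfalso; apply h; simp

lemma inf_Ft (hd : 2 ≤ d) (x : Fin n → ℂ) (s t : ℂ) :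
    eval (evT (hv x 0) s t) (pderiv (Sum.inr 2) (FY d P)) = 0 := by
  rw [FY, map_sub, map_sum, map_sub, map_sum, Finset.sum_eq_zero]
  · rw [Derivation.leibniz, pderiv_pow]
    simp [evT, hv, pderiv_X, show d ≠ 0 by omega]
  · intro q hq
    rw [Derivation.leibniz, pderiv_pow, aeval_emb_ne _ _ (by decide)]
    simp [pderiv_X]

lemma euler_xpart (x : Fin n → ℂ) (s : ℂ) (q : ℕ) :
    ∑ i, x i * eval (evA x s) (pderiv (Sum.inl i) (xpart P q)) = q * eval (evA x s) (xpart P q) := by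
  have h := congrArg (eval (evA x s)) (xpart_wh P q).sum_weight_X_mul_pderiv
  rw [map_sum, Fintype.sum_sum_type] at h
  simpa [wtx, evA] using h

/-- at a point of `Σ₀` -/
lemma sig_pt (hd : 2 ≤ d) (x : Fin n → ℂ) (hx : x ≠ 0) (hS : SCond d P x 0)
    (hY : ∃ ε > (0:ℝ), ∀ (u : HV n → ℂ), u ≠ 0 → ∀ s t : ℂ, ‖s‖ < ε →
      ¬ (OnY d P u s t ∧ AllDerivsVanish d P u s t)) :
    eval (evT (hv x 0) 0 0) (FY d P) = 0 ∧
      eval (evT (hv x 0) 0 0) (pderiv (Sum.inr 1) (FY d P)) ≠ 0 := by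
  obtain ⟨ε, hε, hY⟩ := hY
  have h0 : eval (evT (hv x 0) 0 0) (FY d P) = 0 := by
    rw [inf_F hd]
    have h := euler_xpart (P := P) x 0 d
    rw [Finset.sum_eq_zero (fun i _ => by rw [hS.1 i, mul_zero])] at h
    have hd0 : (d : ℂ) ≠ 0 := by exact_mod_cast (show d ≠ 0 by omega)
    exact (mul_eq_zero.mp h.symm).resolve_left hd0
  refine ⟨h0, fun hs => hY (hv x 0) (fun h => hx ?_) 0 0 (by simpa using hε) ⟨h0, ?_⟩⟩
  · ext i; exact congrFun h (Sum.inl i)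
  · rintro (i | i)
    · rw [inf_Fi hd]; exact hS.1 i
    · fin_cases i
      · exact (inf_F0 hd x 0 0).trans hS.2
      · exact hs
      · exact inf_Ft hd x 0 0

/-! the chart -/

def gC (j : Fin n) (a : Fin n → ℂ) (t : ℂ) : TV n → MvPolynomial (Option (Fin n)) ℂ :=
  Sum.elim (fun i => if i = j then 1 else X (some i) + C (a i)) ![X (some j), X none, C t]

def GC (d : ℕ) (P : MvPolynomial (XS n) ℂ) (j : Fin n) (a : Fin n → ℂ) :
    MvPolynomial (Option (Fin n)) ℂ := aeval (gC j a 0) (FY d P)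

lemma FT_GC (j : Fin n) (a : Fin n → ℂ) (t : ℂ) :
    FT (GC d P j a) j d t = aeval (gC j a t) (FY d P) := by
  have h : ∀ p : MvPolynomial (XS n) ℂ, aeval (gC j a 0) (aeval (R := ℂ) embT p) =
      aeval (gC j a t) (aeval (R := ℂ) embT p) := by
    intro p
    rw [← AlgHom.comp_apply, ← AlgHom.comp_apply]
    congr 1
    ext v : 1
    rcases v with i | i <;> simp [embT, gC]
  rw [FT, GC, FY, map_sub, map_sub, map_sum, map_sum]
  simp only [map_mul, map_pow, h]
  simp [gC]

def uC (j : Fin n) (a : Fin n → ℂ) (y : Option (Fin n) → ℂ) : HV n → ℂ :=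
  hv (fun i => if i = j then 1 else y (some i) + a i) (y (some j))

lemma ev_gC (j : Fin n) (a : Fin n → ℂ) (t : ℂ) (y : Option (Fin n) → ℂ) :
    (fun v => eval y (gC j a t v)) = evT (uC j a y) (y none) t := by
  ext v
  rcases v with i | i
  · by_cases h : i = j <;> simp [gC, evT, uC, hv, h]
  · fin_cases i <;> simp [gC, evT, uC, hv]

lemma ev_FT (j : Fin n) (a : Fin n → ℂ) (t : ℂ) (y : Option (Fin n) → ℂ) :
    eval y (FT (GC d P j a) j d t) = eval (evT (uC j a y) (y none) t) (FY d P) := by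
  rw [FT_GC, eval_aeval, ev_gC]

lemma ev_FT_i (j : Fin n) (a : Fin n → ℂ) (t : ℂ) (y : Option (Fin n) → ℂ) (i : Fin n)
    (hi : i ≠ j) : eval y (pderiv (some i) (FT (GC d P j a) j d t)) =
      eval (evT (uC j a y) (y none) t) (pderiv (Sum.inl i) (FY d P)) := by
  rw [FT_GC, eval_pderiv_aeval, ev_gC, Finset.sum_eq_single (Sum.inl i)]
  · simp [gC, hi]
  · rintro (k | k) _ hk
    · have : k ≠ i := fun h => hk (by rw [h])
      by_cases h : k = j <;> simp [gC, h, pderiv_X, this]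
    · fin_cases k <;> simp [gC, pderiv_X, hi.symm]
  · simp

lemma ev_FT_j (j : Fin n) (a : Fin n → ℂ) (t : ℂ) (y : Option (Fin n) → ℂ) :
    eval y (pderiv (some j) (FT (GC d P j a) j d t)) =
      eval (evT (uC j a y) (y none) t) (pderiv (Sum.inr 0) (FY d P)) := by
  rw [FT_GC, eval_pderiv_aeval, ev_gC, Finset.sum_eq_single (Sum.inr 0)]
  · simp [gC]
  · rintro (k | k) _ hk
    · by_cases h : k = j <;> simp [gC, h, pderiv_X]
    · fin_cases k
      · exact absurd rfl hk
      · simp [gC, pderiv_X]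
      · simp [gC, pderiv_X]
  · simp

lemma ev_G_s (j : Fin n) (a : Fin n → ℂ) (y : Option (Fin n) → ℂ) :
    eval y (pderiv none (GC d P j a)) =
      eval (evT (uC j a y) (y none) 0) (pderiv (Sum.inr 1) (FY d P)) := by
  rw [GC, eval_pderiv_aeval, ev_gC, Finset.sum_eq_single (Sum.inr 1)]
  · simp [gC]
  · rintro (k | k) _ hk
    · by_cases h : k = j <;> simp [gC, h, pderiv_X]
    · fin_cases k
      · simp [gC, pderiv_X]
      · exact absurd rfl hk
      · simp [gC, pderiv_X]
  · simp

lemma chart_iff (j : Fin n) (a : Fin n → ℂ) (t : ℂ) (y : Option (Fin n) → ℂ) :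
    (eval y (FT (GC d P j a) j d t) = 0 ∧ ∀ i, eval y (pderiv (some i) (FT (GC d P j a) j d t)) = 0)
    ↔ OnY d P (uC j a y) (y none) t ∧ FiberDerivsVanish d P (uC j a y) (y none) t := by
  rw [ev_FT]
  unfold OnY FiberDerivsVanish
  constructor
  · rintro ⟨h0, h1⟩
    have hj := h1 j
    rw [ev_FT_j] at hj
    refine ⟨h0, fun i => ?_, hj⟩
    by_cases hi : i = j
    · subst hi
      have h3 := euler_FY (d := d) (P := P) (uC i a y) (y none) t
      rw [hj, h0, Finset.sum_eq_single i] at h3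
      · simpa [uC, hv] using h3
      · intro k _ hk
        rw [← ev_FT_i _ _ _ _ _ hk, h1, mul_zero]
      · simp
    · rw [← ev_FT_i _ _ _ _ _ hi, h1]
  · rintro ⟨h0, h1, h2⟩
    refine ⟨h0, fun i => ?_⟩
    by_cases hi : i = j
    · subst hi; rw [ev_FT_j, h2]
    · rw [ev_FT_i _ _ _ _ _ hi, h1]

lemma uC_ne (j : Fin n) (a : Fin n → ℂ) (y : Option (Fin n) → ℂ) : uC j a y ≠ 0 := by
  intro h
  have := congrFun h (Sum.inl j)
  simp [uC, hv] at this

lemma chart_fin (hd : 2 ≤ d) (j : Fin n) (a : Fin n → ℂ) (t : ℂ) (hS : (SingYst d P 0 t).Finite) :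
    {y : Fin n → ℂ | eval y (z0 (FT (GC d P j a) j d t)) = 0 ∧
      ∀ i, eval y (pderiv i (z0 (FT (GC d P j a) j d t))) = 0}.Finite := by
  refine Set.Finite.of_injOn (f := fun y : Fin n → ℂ =>
    Projectivization.mk ℂ (uC j a (fun o => o.elim 0 y)) (uC_ne j a _)) ?_ ?_ hS
  · rintro y ⟨h1, h2⟩
    rw [eval_z0] at h1
    have h3 := (chart_iff j a t (fun o => o.elim 0 y)).mp ⟨h1, fun i => by
      rw [← eval_z0, ← pderiv_z0]; exact h2 i⟩
    obtain ⟨c, hc⟩ := Projectivization.exists_smul_eq_mk_rep ℂ _ (uC_ne j a (fun o => o.elim 0 y))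
    have hc' : (c : ℂ) • uC j a (fun o => o.elim 0 y) = _ := hc
    change OnY _ _ _ _ _ ∧ FiberDerivsVanish _ _ _ _ _
    rw [← hc', OnY_smul c.ne_zero, Fib_smul hd c.ne_zero]
    exact h3
  · intro y _ y' _ h
    obtain ⟨c, hc⟩ := (Projectivization.mk_eq_mk_iff' ℂ _ _ _ _).mp h
    have hj := congrFun hc (Sum.inl j)
    simp [uC, hv] at hj
    subst hj
    ext i
    by_cases hi : i = j
    · have := congrFun hc (Sum.inr ())
      simp [uC, hv] at this
      rw [hi, this]
    · have := congrFun hc (Sum.inl i)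
      simp [uC, hv, hi] at this
      rw [this]

lemma z0_FT (j : Fin n) (a : Fin n → ℂ) (haj : a j = 0) (t : ℂ) :
    aeval (fun i => X i + C (a i)) (chartEq d P j 0 t) = z0 (FT (GC d P j a) j d t) := by
  rw [FT_GC, chartEq, ← AlgHom.comp_apply, ← AlgHom.comp_apply]
  congr 1
  ext v : 1
  rcases v with i | i
  · by_cases h : i = j <;> simp [gC, h, z0_some]
  · fin_cases i <;> simp [gC, z0_some, z0_none, haj]

lemma pderiv_trans (a : Fin n → ℂ) (i : Fin n) (p : MvPolynomial (Fin n) ℂ) :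
    aeval (fun i => X i + C (a i)) (pderiv i p) =
      pderiv i (aeval (fun i => (X i + C (a i) : MvPolynomial (Fin n) ℂ)) p) := by
  rw [pderiv_aeval_chain, Finset.sum_eq_single i]
  · simp
  · intro k _ hk; simp [pderiv_X, hk]
  · simp

lemma muP_eq (p : PrjInf n) (t : ℂ) : muP d P p 0 t =
    Module.finrank ℂ (MvPowerSeries (Fin n) ℂ ⧸ Ideal.span
      ((fun g => (coeToMvPowerSeries.ringHom g : MvPowerSeries (Fin n) ℂ)) ''
        Set.range fun i => pderiv i (z0 (FT (GC d P (jp p) (chartPt p)) (jp p) d t)))) := by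
  rw [muP, germDim, ← z0_FT _ _ (by simp [chartPt])]
  rw [← Set.range_comp, ← Set.range_comp]
  have h : ((fun g => (coeToMvPowerSeries.ringHom
        (aeval (fun i => X i + C (chartPt p i)) g) : MvPowerSeries (Fin n) ℂ)) ∘
        fun i => pderiv i (chartEq d P (jp p) 0 t)) =
      ((fun g => (coeToMvPowerSeries.ringHom g : MvPowerSeries (Fin n) ℂ)) ∘ fun i =>
        pderiv i (aeval (fun i => (X i + C (chartPt p i) : MvPolynomial (Fin n) ℂ))
          (chartEq d P (jp p) 0 t))) := by
    ext1 i
    simp only [Function.comp_apply, pderiv_trans]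
  rw [h]

lemma lamP_iff (p : PrjInf n) (t0 : ℂ) :
    lamP d P p t0 0 ≠ 0 ↔ ∃ t, muP d P p 0 t < muP d P p 0 t0 := by
  rw [lamP, muGen]
  constructor
  · intro h
    obtain ⟨t, ht⟩ := Nat.sInf_mem (Set.range_nonempty (muP d P p 0))
    exact ⟨t, by omega⟩
  · rintro ⟨t, ht⟩
    have := Nat.sInf_le (Set.mem_range_self (f := muP d P p 0) t)
    omega

lemma chartPt_u (p : PrjInf n) :
    uC (jp p) (chartPt p) 0 = (p.rep (jp p))⁻¹ • hv p.rep 0 := by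
  have := jp_spec p
  ext v
  rcases v with i | i
  · by_cases h : i = jp p
    · simp [uC, hv, h, this]
    · simp [uC, hv, h, chartPt]; field_simp
  · simp [uC, hv]

theorem main_thm (hd : 2 ≤ d) 
    (hdeg : ∃ ε > (0:ℝ), ∀ s : ℂ, ‖s‖ < ε → DegXAt d P s)
    (hfisi : FISIdef d P)
    (hY : ∃ ε > (0:ℝ), ∀ (u : HV n → ℂ), u ≠ 0 → ∀ s t : ℂ, ‖s‖ < ε →
      ¬ (OnY d P u s t ∧ AllDerivsVanish d P u s t))
    (p : PrjInf n) (hp : p ∈ Sigset d P 0) (t₀ : ℂ) :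
    lamP d P p t₀ 0 ≠ 0 ↔
      ∃ (x : ℕ → Fin n → ℂ) (s c : ℕ → ℂ),
        (∀ k, CritPt P (x k) (s k)) ∧
        Tendsto s atTop (nhds 0) ∧
        Tendsto (fun k => c k • x k) atTop (nhds p.rep) ∧
        Tendsto c atTop (nhds 0) ∧
        Tendsto (fun k => eval (evA (x k) (s k)) P) atTop (nhds t₀) := by
  have hj := jp_spec p
  obtain ⟨hs0, hs1⟩ := sig_pt hd p.rep p.rep_nonzero hp hY
  have hji : (p.rep (jp p))⁻¹ ≠ 0 := inv_ne_zero hj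
  have h0 : eval 0 (GC d P (jp p) (chartPt p)) = 0 := by
    rw [GC, eval_aeval, ev_gC, chartPt_u, FY_smul]
    simp [hs0]
  have hc : eval 0 (pderiv none (GC d P (jp p) (chartPt p))) ≠ 0 := by
    rw [ev_G_s, chartPt_u, FYs_smul]
    exact mul_ne_zero (pow_ne_zero _ hji) hs1
  rw [lamP_iff, abs_main hd (GC d P (jp p) (chartPt p)) (jp p) h0 hc
    (fun t => chart_fin hd _ _ t (hfisi.1.2.1 t)) (muP d P p 0) (muP_eq p) t₀]
  constructor
  · rintro ⟨y, t, hy, ht, hk⟩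
    have hyv := tendsto_pi_nhds.mp hy
    have key : ∀ k, CritPt P (fun i => (y k (some (jp p)))⁻¹ * uC (jp p) (chartPt p) (y k) (Sum.inl i))
        (y k none) ∧ eval (evA (fun i => (y k (some (jp p)))⁻¹ *
          uC (jp p) (chartPt p) (y k) (Sum.inl i)) (y k none)) P = t k := by
      intro k
      obtain ⟨h1, h2⟩ := hk k
      rw [← aff_iff hdeg]
      have h3 := (chart_iff _ _ _ _).mp h2
      have h4 : hv (fun i => (y k (some (jp p)))⁻¹ * uC (jp p) (chartPt p) (y k) (Sum.inl i)) 1 =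
          (y k (some (jp p)))⁻¹ • uC (jp p) (chartPt p) (y k) := by
        ext v; rcases v with i | i
        · simp [hv]
        · simp [hv, uC, h1]
      rw [h4, OnY_smul (inv_ne_zero h1), Fib_smul hd (inv_ne_zero h1)]
      exact h3
    refine ⟨_, fun k => y k none, fun k => y k (some (jp p)) * p.rep (jp p), fun k => (key k).1,
      hyv none, ?_, ?_, ?_⟩
    · rw [tendsto_pi_nhds]
      intro i
      have h5 : ∀ k, (p.rep (jp p)) * uC (jp p) (chartPt p) (y k) (Sum.inl i) =
          ((y k (some (jp p)) * p.rep (jp p)) • fun i => (y k (some (jp p)))⁻¹ *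
            uC (jp p) (chartPt p) (y k) (Sum.inl i)) i := by
        intro k
        have := (hk k).1
        simp only [Pi.smul_apply, smul_eq_mul]
        field_simp
      refine Tendsto.congr h5 ?_
      by_cases hi : i = jp p
      · simp [uC, hv, hi]
      · simp only [uC, hv, hi, Sum.elim_inl, if_false]
        have := ((hyv (some i)).add_const (chartPt p i)).const_mul (p.rep (jp p))
        convert this using 2
        simp [chartPt, hi]; field_simp
    · simpa using (hyv (some (jp p))).mul_const (p.rep (jp p))
    · simpa only [(key _).2] using ht
  · rintro ⟨x, s, c, hcr, hs, hcx, hc0, hPt⟩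
    have hcxv := tendsto_pi_nhds.mp hcx
    simp only [Pi.smul_apply, smul_eq_mul] at hcxv
    obtain ⟨N, hN⟩ := eventually_atTop.mp ((hcxv (jp p)).eventually_ne hj)
    have hN' : ∀ k, c (k + N) ≠ 0 ∧ x (k + N) (jp p) ≠ 0 := fun k =>
      mul_ne_zero_iff.mp (hN (k + N) (by omega))
    let y : ℕ → Option (Fin n) → ℂ := fun k o => o.elim (s (k + N)) fun i =>
      if i = jp p then (x (k + N) (jp p))⁻¹ else x (k + N) i / x (k + N) (jp p) - chartPt p i
    have hu : ∀ k, uC (jp p) (chartPt p) (y k) = (x (k + N) (jp p))⁻¹ • hv (x (k + N)) 1 := by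
      intro k
      have := (hN' k).2
      ext v; rcases v with i | i
      · by_cases hi : i = jp p
        · simp [uC, hv, hi, this]
        · simp [uC, hv, hi, y]; field_simp
      · simp [uC, hv, y]
    refine ⟨y, fun k => eval (evA (x (k + N)) (s (k + N))) P, ?_, ?_, fun k => ⟨?_, ?_⟩⟩
    · rw [tendsto_pi_nhds]
      rintro (_ | i)
      · exact (tendsto_add_atTop_iff_nat N).mpr hs
      · have hdiv := fun i => (tendsto_add_atTop_iff_nat N).mpr ((hcxv i).div (hcxv (jp p)) hj)
        by_cases hi : i = jp p
        · have h6 := (tendsto_add_atTop_iff_nat N).mpr (hc0.div (hcxv (jp p)) hj)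
          rw [zero_div] at h6
          refine Tendsto.congr (fun k => ?_) h6
          have := hN' k
          simp only [y, hi, Option.elim_some, if_true, Pi.div_apply]
          field_simp [this.1, this.2]
        · have h6 := (hdiv i).sub_const (chartPt p i)
          rw [show p.rep i / p.rep (jp p) - chartPt p i = 0 by simp [chartPt, hi]] at h6
          refine Tendsto.congr (fun k => ?_) h6
          have := hN' k
          simp only [y, hi, Option.elim_some, if_false, Pi.div_apply]
          rw [mul_div_mul_left _ _ this.1]
    · exact (tendsto_add_atTop_iff_nat N).mpr hPt
    · simpa [y] using (hN' k).2
    · rw [chart_iff, hu, OnY_smul (inv_ne_zero (hN' k).2), Fib_smul hd (inv_ne_zero (hN' k).2)]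
      exact (aff_iff hdeg _ _ _).mpr ⟨hcr _, rfl⟩

end PF

end

/-- For a FISI deformation with nonsingular total space `Y`, a point
`p ∈ Σ₀` and `t₀ ∈ ℂ`: `λ_{p,t₀}(0) ≠ 0` if and only if `(p, 0, t₀)` belongs to the
affine critical locus `Γ_P`, i.e. iff there is a sequence of affine critical points
`(x_k, s_k)` with `s_k → 0`, `[x_k : 1] → p` in `ℙⁿ` (encoded by scalars `c_k → 0` with
`c_k • x_k → p.rep`) and `P(x_k, s_k) → t₀`. -/
theorem stmt15 {n d : ℕ} (hn : 2 ≤ n) (hd : 2 ≤ d) (P : MvPolynomial (XS n) ℂ)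
    (hdeg : ∃ ε > (0:ℝ), ∀ s : ℂ, ‖s‖ < ε → DegXAt d P s)
    (hfisi : FISIdef d P)
    (hY : ∃ ε > (0:ℝ), ∀ (u : HV n → ℂ), u ≠ 0 → ∀ s t : ℂ, ‖s‖ < ε →
      ¬ (OnY d P u s t ∧ AllDerivsVanish d P u s t))
    (p : PrjInf n) (hp : p ∈ Sigset d P 0) (t₀ : ℂ) :
    lamP d P p t₀ 0 ≠ 0 ↔
      ∃ (x : ℕ → Fin n → ℂ) (s c : ℕ → ℂ),
        (∀ k, CritPt P (x k) (s k)) ∧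
        Tendsto s atTop (nhds 0) ∧
        Tendsto (fun k => c k • x k) atTop (nhds p.rep) ∧
        Tendsto c atTop (nhds 0) ∧
        Tendsto (fun k => eval (evA (x k) (s k)) P) atTop (nhds t₀) := by
  exact PF.main_thm hd hdeg hfisi hY p hp t₀
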